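/- arXiv:0802.1375 — 4 statements merged into one kernel-verified Lean document; each statement's English description precedes it below -/
import Mathlib

section
/- Let F₁ and F₂ be autoconjugate functions on X×X* that are representers for maximal monotone operators A₁: X⇉X* and A₂: X⇉X*, respectively. Suppose that ⋃_{λ>0} λ(P_X dom F₁ − P_X dom F₂) is a closed linear subspace of X, where P_X: X×X* → X, (x,x*) ↦ x. Then the function F: X×X* → (−∞,+∞] defined by F(x,x*) = inf_{y*∈X*} ( F₁(x,y*) + F₂(x, x*−y*) ) is an autoconjugate representer for A₁+A₂, and for every (x,x*) ∈ X×X* the infimum defining F(x,x*) is attained. -/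
noncomputable section
open Filter Topology

/-- The Fenchel conjugate of `F : X × X* → (-∞,+∞]`, as a function on `X* × X`:
`F*(x*,x) = sup_{(y,y*)} (⟨y,x*⟩ + ⟨x,y*⟩ - F(y,y*))`. -/
def conj2 {X : Type*} [NormedAddCommGroup X] [NormedSpace ℝ X]
    (F : X × (X →L[ℝ] ℝ) → EReal) : (X →L[ℝ] ℝ) × X → EReal :=
  fun p => ⨆ q : X × (X →L[ℝ] ℝ), ((p.1 q.1 + q.2 p.2 : ℝ) : EReal) - F q

/-- `F` is autoconjugate: `F*(x*,x) = F(x,x*)` for all `(x,x*)`. -/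
def Autoconjugate {X : Type*} [NormedAddCommGroup X] [NormedSpace ℝ X]
    (F : X × (X →L[ℝ] ℝ) → EReal) : Prop :=
  ∀ (x : X) (x' : X →L[ℝ] ℝ), conj2 F (x', x) = F (x, x')

/-- `F` is a representer for the set-valued operator `A : X ⇉ X*`:
`gra A = {(x,x*) : F(x,x*) = ⟨x,x*⟩}`. -/
def IsRepresenter {X : Type*} [NormedAddCommGroup X] [NormedSpace ℝ X]
    (F : X × (X →L[ℝ] ℝ) → EReal) (A : X → Set (X →L[ℝ] ℝ)) : Prop :=
  ∀ (x : X) (x' : X →L[ℝ] ℝ), x' ∈ A x ↔ F (x, x') = ((x' x : ℝ) : EReal)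

/-- A set-valued operator `A : X ⇉ X*` is monotone. -/
def MonotoneOp {X : Type*} [NormedAddCommGroup X] [NormedSpace ℝ X]
    (A : X → Set (X →L[ℝ] ℝ)) : Prop :=
  ∀ ⦃x y : X⦄ ⦃x' y' : X →L[ℝ] ℝ⦄, x' ∈ A x → y' ∈ A y → 0 ≤ (x' - y') (x - y)

/-- A set-valued operator is maximal monotone if it is monotone and admits no proper
monotone extension (in the sense of graph inclusion). -/
def MaximalMonotoneOp {X : Type*} [NormedAddCommGroup X] [NormedSpace ℝ X]
    (A : X → Set (X →L[ℝ] ℝ)) : Prop :=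
  MonotoneOp A ∧ ∀ B : X → Set (X →L[ℝ] ℝ), MonotoneOp B → (∀ x, A x ⊆ B x) → B = A

/-- The quadratic function `q_A(x) = ½⟨x,Ax⟩` associated with a continuous linear
`A : X → X*`. -/
def qF {X : Type*} [NormedAddCommGroup X] [NormedSpace ℝ X]
    (A : X →L[ℝ] X →L[ℝ] ℝ) : X → ℝ :=
  fun x => (1 / 2) * A x x

/-- The Fenchel conjugate of a real-valued function `φ : X → ℝ`, as an `EReal`-valued
function on `X*`: `φ*(x*) = sup_y (⟨y,x*⟩ - φ(y))`. -/
def legendre {X : Type*} [NormedAddCommGroup X] [NormedSpace ℝ X]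
    (φ : X → ℝ) : (X →L[ℝ] ℝ) → EReal :=
  fun x' => ⨆ y : X, ((x' y - φ y : ℝ) : EReal)

/-- The symmetric part `A₊ = ½A + ½A*` of a continuous linear `A : X → X*`, where the
adjoint (restricted to `X`) is `A.flip`. -/
def symPart {X : Type*} [NormedAddCommGroup X] [NormedSpace ℝ X]
    (A : X →L[ℝ] X →L[ℝ] ℝ) : X →L[ℝ] X →L[ℝ] ℝ :=
  (1 / 2 : ℝ) • (A + A.flip)

/-- The antisymmetric part `A∘ = ½A - ½A*` of a continuous linear `A : X → X*`. -/
def antiPart {X : Type*} [NormedAddCommGroup X] [NormedSpace ℝ X]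
    (A : X →L[ℝ] X →L[ℝ] ℝ) : X →L[ℝ] X →L[ℝ] ℝ :=
  (1 / 2 : ℝ) • (A - A.flip)

/-- The Fitzpatrick function of a continuous linear `A : X → X*`:
`F_A(x,x*) = sup_y (⟨x,Ay⟩ + ⟨y,x*⟩ - ⟨y,Ay⟩)`. -/
def fitz {X : Type*} [NormedAddCommGroup X] [NormedSpace ℝ X]
    (A : X →L[ℝ] X →L[ℝ] ℝ) : X × (X →L[ℝ] ℝ) → EReal :=
  fun p => ⨆ y : X, ((A y p.1 + p.2 y - A y y : ℝ) : EReal)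

section ConvexSets

variable {V : Type*} [NormedAddCommGroup V] [NormedSpace ℝ V]

/-- In a Banach space, an increasing sequence of closed convex sets whose positive multiples cover
the space contains a neighbourhood of the origin. -/
theorem exists_zero_mem_interior_of_cover [CompleteSpace V] {C : ℕ → Set V} (hmono : Monotone C)
    (hconv : ∀ n, Convex ℝ (C n)) (hclosed : ∀ n, IsClosed (C n))
    (hcover : ∀ z, ∃ n, ∃ l : ℝ, 0 < l ∧ ∃ c ∈ C n, z = l • c) :
    ∃ n, (0 : V) ∈ interior (C n) := by
  have hscale : ∀ n : ℕ, Continuous fun z : V => (n + 1 : ℝ)⁻¹ • z := fun n => by fun_prop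
  obtain ⟨n₀, hn₀⟩ : ∃ n, (0 : V) ∈ C n := by
    obtain ⟨n, l, hl, c, hc, h⟩ := hcover 0
    obtain rfl : c = 0 := by simpa [hl.ne'] using h.symm
    exact ⟨n, hc⟩
  obtain ⟨n, z, hz⟩ : ∃ n : ℕ, (interior ((fun z : V => (n + 1 : ℝ)⁻¹ • z) ⁻¹' C n)).Nonempty := by
    refine nonempty_interior_of_iUnion_of_closed (fun n => (hclosed n).preimage (hscale n)) ?_
    refine Set.eq_univ_of_forall fun z => ?_
    obtain ⟨n, l, hl, c, hc, rfl⟩ := hcover z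
    obtain ⟨k, hk⟩ := exists_nat_ge l
    refine Set.mem_iUnion.2 ⟨n + n₀ + k, ?_⟩
    have hle : l ≤ ((n + n₀ + k : ℕ) : ℝ) + 1 := by
      have : (k : ℝ) ≤ ((n + n₀ + k : ℕ) : ℝ) := by exact_mod_cast Nat.le_add_left k (n + n₀)
      linarith
    have hpos : (0 : ℝ) < ((n + n₀ + k : ℕ) : ℝ) + 1 := hl.trans_le hle
    simp only [Set.mem_preimage, smul_smul]
    refine (hconv _).smul_mem_of_zero_mem (hmono (by omega) hn₀) (hmono (by omega) hc)
      ⟨by positivity, ?_⟩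
    rw [inv_mul_eq_div]
    exact (div_le_one hpos).2 hle
  have hne : (n + 1 : ℝ)⁻¹ ≠ 0 := by positivity
  have hz' : (n + 1 : ℝ)⁻¹ • z ∈ interior (C n) := by
    have := (Homeomorph.smulOfNeZero (α := V) _ hne).preimage_interior (C n)
    exact this.symm.subset hz
  obtain ⟨m, l, hl, c, hc, h⟩ := hcover (-((n + 1 : ℝ)⁻¹ • z))
  have h₁ := interior_mono (hmono (le_max_left n m)) hz'
  have h₂ := hmono (le_max_right n m) hc
  refine ⟨max n m, ?_⟩
  have := (hconv (max n m)).combo_interior_self_mem_interior h₁ h₂ (a := 1 / (1 + l))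
    (b := l / (1 + l)) (by positivity) (by positivity) (by field_simp)
  convert this using 1
  have e : (n + 1 : ℝ)⁻¹ • z = -(l • c) := by rw [← h, neg_neg]
  rw [e, div_eq_inv_mul, div_eq_inv_mul, mul_smul, mul_smul, one_smul, smul_neg, neg_add_cancel]

/-- A convex subset of `V × ℝ` that lies above `0` on the vertical axis and contains a horizontal
neighbourhood of a point of this axis is, up to vertical translations, above the graph of a
continuous linear functional. -/
theorem exists_clm_le_of_convex {S : Set (V × ℝ)} (hconv : Convex ℝ S)
    (hup : ∀ z ρ σ, (z, ρ) ∈ S → ρ ≤ σ → (z, σ) ∈ S) (hnonneg : ∀ ρ, (0, ρ) ∈ S → 0 ≤ ρ) {M : ℝ}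
    (hM : ∀ᶠ z in 𝓝 (0 : V), (z, M) ∈ S) :
    ∃ g : V →L[ℝ] ℝ, ∀ z ρ, (z, ρ) ∈ S → g z ≤ ρ := by
  have hint : ((0 : V), M + 1) ∈ interior S := by
    rw [mem_interior_iff_mem_nhds, nhds_prod_eq]
    filter_upwards [hM.prod_mk (lt_mem_nhds (show M < M + 1 by linarith))] with p hp
    exact hup _ _ _ hp.1 hp.2.le
  have hdisj : ((0 : V), (0 : ℝ)) ∉ interior S := by
    intro h
    rw [mem_interior_iff_mem_nhds] at h
    have hc : Continuous fun ρ : ℝ => ((0 : V), ρ) := by fun_prop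
    have := hc.continuousAt.preimage_mem_nhds h
    obtain ⟨ρ, hρ, hρS⟩ := (Filter.nonempty_of_mem
      (inter_mem (nhdsWithin_le_nhds this) (self_mem_nhdsWithin (s := Set.Iio (0 : ℝ)))))
    exact absurd (hnonneg _ hρ) (not_le.2 hρS)
  obtain ⟨f, hf⟩ := geometric_hahn_banach_open_point hconv.interior isOpen_interior hdisj
  have hS : ∀ p ∈ S, f p ≤ 0 := by
    intro p hp
    have hcl : p ∈ closure (interior S) := by
      rw [hconv.closure_interior_eq_closure_of_nonempty_interior ⟨_, hint⟩]
      exact subset_closure hp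
    refine closure_minimal (fun q hq => ?_) (isClosed_Iic.preimage f.continuous) hcl
    exact (hf q hq).le.trans_eq (map_zero f)
  have hdecomp : ∀ z ρ, f (z, ρ) = f (z, 0) + ρ * f (0, 1) := by
    intro z ρ
    rw [← smul_eq_mul, ← map_smul, ← map_add]
    simp
  have hneg : f (0, 1) < 0 := by
    have h₁ := hf _ hint
    have h₂ : 0 ≤ M := hnonneg _ hM.self_of_nhds
    rw [hdecomp, ← Prod.zero_eq_mk, map_zero] at h₁
    by_contra! h
    nlinarith
  refine ⟨(-f (0, 1))⁻¹ • f.comp (ContinuousLinearMap.inl ℝ V ℝ), fun z ρ h => ?_⟩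
  have h₁ := hS _ h
  rw [hdecomp] at h₁
  simp only [smul_apply, ContinuousLinearMap.comp_apply,
    ContinuousLinearMap.inl_apply, smul_eq_mul]
  rw [inv_mul_le_iff₀ (neg_pos.2 hneg)]
  linarith

end ConvexSets

section SelfPolar

variable {X : Type*} [NormedAddCommGroup X] [NormedSpace ℝ X]

/-- The property of a subset of `X × X* × ℝ` characterising epigraphs of autoconjugate
functions. -/
def SelfPolar (E : X → (X →L[ℝ] ℝ) → ℝ → Prop) : Prop :=
  ∀ a u r, E a u r ↔ ∀ b v s, E b v s → u b + v a ≤ r + s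

/-- The projection to `X` of the points of `E` at height at most `n` whose components have norm at
most `n`. -/
def truncation (E : X → (X →L[ℝ] ℝ) → ℝ → Prop) (n : ℝ) : Set X :=
  {a | ∃ u, ‖a‖ ≤ n ∧ ‖u‖ ≤ n ∧ E a u n}

variable {E E₁ E₂ : X → (X →L[ℝ] ℝ) → ℝ → Prop}

theorem SelfPolar.mono (hE : SelfPolar E) {a u r s} (h : E a u r) (hrs : r ≤ s) : E a u s :=
  (hE a u s).2 fun b v t ht => by linarith [(hE a u r).1 h b v t ht]

theorem SelfPolar.combo (hE : SelfPolar E) {a b u v} {r s : ℝ} (h₁ : E a u r) (h₂ : E b v s)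
    {c d : ℝ} (hc : 0 ≤ c) (hd : 0 ≤ d) (hcd : c + d = 1) :
    E (c • a + d • b) (c • u + d • v) (c * r + d * s) := by
  refine (hE _ _ _).2 fun y w t ht => ?_
  have e₁ := mul_le_mul_of_nonneg_left ((hE a u r).1 h₁ y w t ht) hc
  have e₂ := mul_le_mul_of_nonneg_left ((hE b v s).1 h₂ y w t ht) hd
  have e₃ : t = c * t + d * t := by rw [← add_mul, hcd, one_mul]
  simp only [map_add, map_smul, add_apply, smul_apply,
    smul_eq_mul]
  linarith

theorem SelfPolar.convex_truncation (hE : SelfPolar E) (n : ℝ) : Convex ℝ (truncation E n) := by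
  rintro a ⟨u, ha, hu, hau⟩ b ⟨v, hb, hv, hbv⟩ c d hc hd hcd
  have hball : ∀ {Y : Type _} [NormedAddCommGroup Y] [NormedSpace ℝ Y] {y z : Y},
      ‖y‖ ≤ n → ‖z‖ ≤ n → ‖c • y + d • z‖ ≤ n := by
    intro Y _ _ y z hy hz
    have := convex_closedBall (0 : Y) n (mem_closedBall_zero_iff.2 hy)
      (mem_closedBall_zero_iff.2 hz) hc hd hcd
    exact mem_closedBall_zero_iff.1 this
  refine ⟨c • u + d • v, hball ha hb, hball hu hv, ?_⟩
  have := hE.combo hau hbv hc hd hcd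
  rwa [← add_mul, hcd, one_mul] at this

theorem SelfPolar.truncation_mono (hE : SelfPolar E) : Monotone (truncation E) :=
  fun _ _ h _ ⟨u, ha, hu, hau⟩ => ⟨u, ha.trans h, hu.trans h, hE.mono hau h⟩

/-- The embedding of `X` in its bidual with the weak-star topology. -/
def toWeakBidual (x : X) : WeakDual ℝ (X →L[ℝ] ℝ) :=
  StrongDual.toWeakDual (NormedSpace.inclusionInDoubleDual ℝ X x)

theorem continuous_toWeakBidual : Continuous (toWeakBidual (X := X)) :=
  WeakDual.continuous_of_continuous_eval fun u => u.continuous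

theorem injective_toWeakBidual : Function.Injective (toWeakBidual (X := X)) := fun _ _ h =>
  (NormedSpace.inclusionInDoubleDualLi ℝ).injective (StrongDual.toWeakDual.injective h)

theorem isCompact_setOf_norm_toStrongDual_le {Y : Type*} [NormedAddCommGroup Y] [NormedSpace ℝ Y]
    (n : ℝ) : IsCompact {α : WeakDual ℝ Y | ‖WeakDual.toStrongDual α‖ ≤ n} := by
  convert WeakDual.isCompact_closedBall (0 : StrongDual ℝ Y) n using 1
  ext α
  simp only [Set.mem_ofPred_eq, Set.mem_preimage]
  exact (mem_closedBall_zero_iff (E := StrongDual ℝ Y)).symm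

theorem SelfPolar.isCompact_image_truncation (hE : SelfPolar E)
    (hrefl : Function.Surjective (NormedSpace.inclusionInDoubleDual ℝ X)) (n : ℝ) :
    IsCompact (toWeakBidual '' truncation E n) := by
  let K : Set (WeakDual ℝ (X →L[ℝ] ℝ) × WeakDual ℝ X) :=
    ({α | ‖WeakDual.toStrongDual α‖ ≤ n} ×ˢ {u | ‖WeakDual.toStrongDual u‖ ≤ n}) ∩
      {p | ∀ b v s, E b v s → p.2 b + p.1 v ≤ n + s}
  have hK : IsCompact K := by
    refine ((isCompact_setOf_norm_toStrongDual_le n).prod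
      (isCompact_setOf_norm_toStrongDual_le n)).inter_right ?_
    simp only [Set.ofPred_forall]
    refine isClosed_iInter fun b => isClosed_iInter fun v => isClosed_iInter fun s =>
      isClosed_iInter fun _ => isClosed_le ?_ continuous_const
    exact ((WeakDual.eval_continuous b).comp continuous_snd).add
      ((WeakDual.eval_continuous v).comp continuous_fst)
  convert hK.image continuous_fst using 1
  ext α
  constructor
  · rintro ⟨a, ⟨u, ha, hu, hau⟩, rfl⟩
    refine ⟨(toWeakBidual a, StrongDual.toWeakDual u), ⟨⟨?_, ?_⟩, ?_⟩, rfl⟩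
    · exact ((NormedSpace.inclusionInDoubleDualLi ℝ).norm_map a).trans_le ha
    · exact hu
    · exact (hE a u n).1 hau
  · rintro ⟨⟨α, u⟩, ⟨⟨hα, hu⟩, h⟩, rfl⟩
    obtain ⟨a, ha⟩ := hrefl (WeakDual.toStrongDual α)
    have haα : toWeakBidual a = α := by rw [toWeakBidual, ha]; rfl
    refine ⟨a, ⟨WeakDual.toStrongDual u, ?_, hu, (hE _ _ _).2 ?_⟩, haα⟩
    · rw [← (NormedSpace.inclusionInDoubleDualLi ℝ).norm_map a]
      exact (congrArg norm ha).trans_le hα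
    · intro b v s hb
      have := h b v s hb
      rwa [← haα] at this

open scoped Pointwise in
theorem SelfPolar.isClosed_truncation_sub (hE₁ : SelfPolar E₁) (hE₂ : SelfPolar E₂)
    (hrefl : Function.Surjective (NormedSpace.inclusionInDoubleDual ℝ X)) (n : ℝ) :
    IsClosed (truncation E₁ n - truncation E₂ n) := by
  have hcont : Continuous fun p : WeakDual ℝ (X →L[ℝ] ℝ) × WeakDual ℝ (X →L[ℝ] ℝ) =>
      p.1 - p.2 := WeakDual.continuous_of_continuous_eval fun u =>
        ((WeakDual.eval_continuous u).comp continuous_fst).sub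
          ((WeakDual.eval_continuous u).comp continuous_snd)
  have h := (((hE₁.isCompact_image_truncation hrefl n).prod
    (hE₂.isCompact_image_truncation hrefl n)).image hcont).isClosed.preimage
      continuous_toWeakBidual
  rw [Set.sub_image_prod] at h
  convert h using 1
  have hsub : ∀ a b : X, toWeakBidual (a - b) = toWeakBidual a - toWeakBidual b := fun a b => by
    simp [toWeakBidual]
  ext z
  constructor
  · rintro ⟨a, ha, b, hb, rfl⟩
    exact ⟨_, ⟨a, ha, rfl⟩, _, ⟨b, hb, rfl⟩, (hsub a b).symm⟩
  · rintro ⟨_, ⟨a, ha, rfl⟩, _, ⟨b, hb, rfl⟩, h⟩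
    exact ⟨a, ha, b, hb, injective_toWeakBidual ((hsub a b).trans h)⟩

open scoped Pointwise in
/-- Fenchel duality under the Attouch–Brezis constraint qualification: a continuous linear
functional separating the two variables. -/
theorem SelfPolar.exists_separating (hE₁ : SelfPolar E₁) (hE₂ : SelfPolar E₂) [CompleteSpace X]
    (hrefl : Function.Surjective (NormedSpace.inclusionInDoubleDual ℝ X))
    (V : Submodule ℝ X) (hV : IsClosed (V : Set X))
    (hCQ : ∀ z, z ∈ V ↔ ∃ l : ℝ, 0 < l ∧ ∃ a u r, E₁ a u r ∧ ∃ b v s, E₂ b v s ∧ z = l • (a - b))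
    {x : X} {x' : X →L[ℝ] ℝ} {m : ℝ}
    (hm : ∀ a u v r s, E₁ a u r → E₂ a v s → x' a + u x + v x ≤ r + s + m) :
    ∃ y' : X →L[ℝ] ℝ, ∀ a u r b v s, E₁ a u r → E₂ b v s →
      (y' a + u x) + ((x' - y') b + v x) ≤ r + s + m := by
  have : CompleteSpace V := hV.completeSpace_coe
  let S : Set (V × ℝ) := {p | ∃ a u r b v s, E₁ a u r ∧ E₂ b v s ∧ (p.1 : X) = a - b ∧
    r + s + m - (x' b + u x + v x) ≤ p.2}
  let C : ℕ → Set V := fun n => V.subtypeL ⁻¹' (truncation E₁ n - truncation E₂ n)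
  obtain ⟨n, hn⟩ : ∃ n, (0 : V) ∈ interior (C n) := by
    refine exists_zero_mem_interior_of_cover (fun n k hnk => ?_) (fun n => ?_) (fun n => ?_)
      fun z => ?_
    · have h : (n : ℝ) ≤ k := by exact_mod_cast hnk
      exact Set.preimage_mono (Set.sub_subset_sub (hE₁.truncation_mono h) (hE₂.truncation_mono h))
    · exact ((hE₁.convex_truncation n).sub (hE₂.convex_truncation n)).linear_preimage V.subtype
    · exact (hE₁.isClosed_truncation_sub hE₂ hrefl n).preimage V.subtypeL.continuous
    · obtain ⟨l, hl, a, u, r, h₁, b, v, s, h₂, hz⟩ := (hCQ z).1 z.2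
      obtain ⟨n, hn⟩ := exists_nat_ge (max ‖a‖ (max ‖u‖ (max r (max ‖b‖ (max ‖v‖ s)))))
      simp only [max_le_iff] at hn
      obtain ⟨ha, hu, hr, hb, hv, hs⟩ := hn
      have hab : a - b = l⁻¹ • (z : X) := by rw [hz, inv_smul_smul₀ hl.ne']
      refine ⟨n, l, hl, l⁻¹ • z, ?_, (smul_inv_smul₀ hl.ne' z).symm⟩
      exact ⟨a, ⟨u, ha, hu, hE₁.mono h₁ hr⟩, b, ⟨v, hb, hv, hE₂.mono h₂ hs⟩, hab⟩
  have hconv : Convex ℝ S := by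
    rintro ⟨z, ρ⟩ ⟨a, u, r, b, v, s, h₁, h₂, hz, hρ⟩ ⟨z', ρ'⟩
      ⟨a', u', r', b', v', s', h₁', h₂', hz', hρ'⟩ c d hc hd hcd
    refine ⟨_, _, _, _, _, _, hE₁.combo h₁ h₁' hc hd hcd, hE₂.combo h₂ h₂' hc hd hcd, ?_, ?_⟩
    · simp only at hz hz'
      simp only [Prod.smul_mk, Prod.mk_add_mk, Submodule.coe_add, Submodule.coe_smul, hz, hz']
      module
    · have e₁ := mul_le_mul_of_nonneg_left hρ hc
      have e₂ := mul_le_mul_of_nonneg_left hρ' hd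
      have e₃ : m = c * m + d * m := by rw [← add_mul, hcd, one_mul]
      simp only [map_add, map_smul, add_apply, smul_apply,
        smul_eq_mul, Prod.smul_mk, Prod.mk_add_mk] at e₁ e₂ ⊢
      linarith
  have hbdd : ∀ᶠ z in 𝓝 (0 : V), (z, n + n + m + (‖x'‖ * n + n * ‖x‖ + n * ‖x‖)) ∈ S := by
    filter_upwards [mem_interior_iff_mem_nhds.1 hn] with z hz
    obtain ⟨a, ⟨u, -, hu, h₁⟩, b, ⟨v, hb, hv, h₂⟩, hab⟩ := hz
    refine ⟨a, u, n, b, v, n, h₁, h₂, hab.symm, ?_⟩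
    have e : ∀ (w : X →L[ℝ] ℝ) (y : X) {p q : ℝ}, ‖w‖ ≤ p → ‖y‖ ≤ q → -(p * q) ≤ w y :=
      fun w y p q hw hy => (abs_le.1 ((w.le_opNorm y).trans
        (mul_le_mul hw hy (norm_nonneg _) ((norm_nonneg _).trans hw)))).1
    linarith [e x' b le_rfl hb, e u x hu le_rfl, e v x hv le_rfl]
  obtain ⟨g, hg⟩ := exists_clm_le_of_convex hconv
    (fun z ρ σ ⟨a, u, r, b, v, s, h₁, h₂, hz, hρ⟩ h => ⟨a, u, r, b, v, s, h₁, h₂, hz, hρ.trans h⟩)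
    (fun ρ ⟨a, u, r, b, v, s, h₁, h₂, hz, hρ⟩ => by
      obtain rfl : a = b := sub_eq_zero.1 hz.symm
      linarith [hm a u v r s h₁ h₂]) hbdd
  obtain ⟨y', hy', -⟩ := exists_extension_norm_eq V g
  refine ⟨y', fun a u r b v s h₁ h₂ => ?_⟩
  have hab : a - b ∈ V := (hCQ _).2 ⟨1, one_pos, a, u, r, h₁, b, v, s, h₂, (one_smul _ _).symm⟩
  have h := hg ⟨a - b, hab⟩ _ ⟨a, u, r, b, v, s, h₁, h₂, rfl, le_rfl⟩
  rw [← hy' ⟨a - b, hab⟩, map_sub] at h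
  rw [sub_apply]
  linarith

/-- Strong duality with attainment for two self-polar sets. -/
theorem SelfPolar.exists_add_eq (hE₁ : SelfPolar E₁) (hE₂ : SelfPolar E₂) [CompleteSpace X]
    (hrefl : Function.Surjective (NormedSpace.inclusionInDoubleDual ℝ X))
    (V : Submodule ℝ X) (hV : IsClosed (V : Set X))
    (hCQ : ∀ z, z ∈ V ↔ ∃ l : ℝ, 0 < l ∧ ∃ a u r, E₁ a u r ∧ ∃ b v s, E₂ b v s ∧ z = l • (a - b))
    {x : X} {x' : X →L[ℝ] ℝ} {m : ℝ}
    (hm : ∀ a u v r s, E₁ a u r → E₂ a v s → x' a + u x + v x ≤ r + s + m) :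
    ∃ y' p q, E₁ x y' p ∧ E₂ x (x' - y') q ∧ p + q = m := by
  obtain ⟨y', hy'⟩ := hE₁.exists_separating hE₂ hrefl V hV hCQ hm
  obtain ⟨-, -, a₀, u₀, r₀, h₁, b₀, v₀, s₀, h₂, -⟩ := (hCQ 0).1 V.zero_mem
  let T : Set ℝ := {t | ∃ a u r, E₁ a u r ∧ t = y' a + u x - r}
  have hT : T.Nonempty := ⟨_, a₀, u₀, r₀, h₁, rfl⟩
  have hub : ∀ b v s, E₂ b v s → s + m - ((x' - y') b + v x) ∈ upperBounds T := by
    rintro b v s h _ ⟨a, u, r, h', rfl⟩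
    linarith [hy' a u r b v s h' h]
  refine ⟨y', sSup T, m - sSup T, (hE₁ _ _ _).2 fun a u r h => ?_, (hE₂ _ _ _).2 fun b v s h => ?_,
    by ring⟩
  · linarith [le_csSup ⟨_, hub _ _ _ h₂⟩ (show y' a + u x - r ∈ T from ⟨a, u, r, h, rfl⟩)]
  · linarith [csSup_le hT (hub b v s h)]

end SelfPolar

section Autoconjugate

variable {X : Type*} [NormedAddCommGroup X] [NormedSpace ℝ X] {F : X × (X →L[ℝ] ℝ) → EReal}

theorem Autoconjugate.selfPolar_epigraph (hF : Autoconjugate F) (hbot : ∀ p, F p ≠ ⊥) :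
    SelfPolar fun a u r => F (a, u) ≤ (r : EReal) := by
  intro a u r
  beta_reduce
  rw [← hF a u, conj2, iSup_le_iff, Prod.forall]
  refine forall₂_congr fun b v => ?_
  have hbv := hbot (b, v)
  generalize F (b, v) = f at hbv ⊢
  induction f using EReal.rec with
  | bot => contradiction
  | top => simp
  | coe t =>
    norm_cast
    exact ⟨fun h s hs => by linarith, fun h => by linarith [h t le_rfl]⟩

theorem Autoconjugate.pairing_le (hF : Autoconjugate F) (hbot : ∀ p, F p ≠ ⊥) (a : X)
    (u : X →L[ℝ] ℝ) : ((u a : ℝ) : EReal) ≤ F (a, u) := by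
  have hself : ∀ r : ℝ, F (a, u) ≤ r → ∀ b v (s : ℝ), F (b, v) ≤ s → u b + v a ≤ r + s :=
    fun r => (hF.selfPolar_epigraph hbot a u r).1
  have := hbot (a, u)
  revert hself this
  induction h : F (a, u) using EReal.rec with
  | bot => simp
  | top => simp
  | coe t =>
    intro hself _
    have := hself t le_rfl a u t h.le
    exact_mod_cast (by linarith : u a ≤ t)

theorem exists_coe_of_add_ne_top {p q : EReal} (hp : p ≠ ⊥) (hq : q ≠ ⊥) (h : p + q ≠ ⊤) :
    ∃ r s : ℝ, p = r ∧ q = s := by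
  induction p using EReal.rec <;> induction q using EReal.rec <;> simp_all

variable {F₁ F₂ : X × (X →L[ℝ] ℝ) → EReal}

/-- Weak duality for the partial inf-convolution. -/
theorem Autoconjugate.conj2_le_add (hF₁ : Autoconjugate F₁) (hF₂ : Autoconjugate F₂)
    (hbot₁ : ∀ p, F₁ p ≠ ⊥) (hbot₂ : ∀ p, F₂ p ≠ ⊥)
    (hF : ∀ x x', F (x, x') = ⨅ y' : X →L[ℝ] ℝ, F₁ (x, y') + F₂ (x, x' - y'))
    (x : X) (x' y' : X →L[ℝ] ℝ) : conj2 F (x', x) ≤ F₁ (x, y') + F₂ (x, x' - y') := by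
  by_cases htop : F₁ (x, y') + F₂ (x, x' - y') = ⊤
  · simp [htop]
  obtain ⟨p, q, hp, hq⟩ := exists_coe_of_add_ne_top (hbot₁ _) (hbot₂ _) htop
  refine iSup_le fun ⟨y, w⟩ => ?_
  have key : ((x' y + w x - (p + q) : ℝ) : EReal) ≤ F (y, w) := by
    rw [hF]
    refine le_iInf fun z' => ?_
    by_cases htop' : F₁ (y, z') + F₂ (y, w - z') = ⊤
    · simp [htop']
    obtain ⟨r, s, hr, hs⟩ := exists_coe_of_add_ne_top (hbot₁ _) (hbot₂ _) htop'
    have h₁ := (hF₁.selfPolar_epigraph hbot₁ x y' p).1 hp.le y z' r hr.le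
    have h₂ := (hF₂.selfPolar_epigraph hbot₂ x (x' - y') q).1 hq.le y (w - z') s hs.le
    rw [hr, hs, ← EReal.coe_add, EReal.coe_le_coe_iff]
    simp only [sub_apply] at h₂
    linarith
  rw [hp, hq, ← EReal.coe_add]
  generalize F (y, w) = f at key ⊢
  induction f using EReal.rec with
  | bot => exact absurd key (EReal.bot_lt_coe _).not_ge
  | top => simp
  | coe t =>
    norm_cast at key ⊢
    linarith

end Autoconjugate

/-- Proposition 2.1, partial inf-convolution of autoconjugate representers.
If `F₁, F₂` are autoconjugate representers for maximal monotone `A₁, A₂` and the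
constraint qualification `⋃_{λ>0} λ(P_X dom F₁ - P_X dom F₂)` is a closed linear subspace
of `X`, then `F(x,x*) = inf_{y*} (F₁(x,y*) + F₂(x,x*-y*))` is an autoconjugate representer
for `A₁ + A₂`, and the infimum is always attained. -/
theorem stmt0 {X : Type*} [NormedAddCommGroup X] [NormedSpace ℝ X] [CompleteSpace X]
    (hrefl : Function.Surjective (NormedSpace.inclusionInDoubleDual ℝ X))
    (F₁ F₂ : X × (X →L[ℝ] ℝ) → EReal)
    (hF₁bot : ∀ p, F₁ p ≠ ⊥) (hF₂bot : ∀ p, F₂ p ≠ ⊥)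
    (hF₁ : Autoconjugate F₁) (hF₂ : Autoconjugate F₂)
    (A₁ A₂ : X → Set (X →L[ℝ] ℝ))
    (hA₁ : MaximalMonotoneOp A₁) (hA₂ : MaximalMonotoneOp A₂)
    (hrep₁ : IsRepresenter F₁ A₁) (hrep₂ : IsRepresenter F₂ A₂)
    (V : Submodule ℝ X) (hVclosed : IsClosed (V : Set X))
    (hCQ : (V : Set X) =
      {z : X | ∃ l : ℝ, 0 < l ∧ ∃ p ∈ {p : X × (X →L[ℝ] ℝ) | F₁ p ≠ ⊤},
        ∃ q ∈ {q : X × (X →L[ℝ] ℝ) | F₂ q ≠ ⊤}, z = l • (p.1 - q.1)})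
    (F : X × (X →L[ℝ] ℝ) → EReal)
    (hFdef : ∀ (x : X) (x' : X →L[ℝ] ℝ),
      F (x, x') = ⨅ y' : X →L[ℝ] ℝ, F₁ (x, y') + F₂ (x, x' - y')) :
    Autoconjugate F ∧
    IsRepresenter F (fun x => {x' | ∃ a ∈ A₁ x, ∃ b ∈ A₂ x, x' = a + b}) ∧
    ∀ (x : X) (x' : X →L[ℝ] ℝ), ∃ y' : X →L[ℝ] ℝ,
      F (x, x') = F₁ (x, y') + F₂ (x, x' - y') := by
  have hcq : ∀ z, z ∈ V ↔ ∃ l : ℝ, 0 < l ∧ ∃ a u r, F₁ (a, u) ≤ ((r : ℝ) : EReal) ∧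
      ∃ b v s, F₂ (b, v) ≤ ((s : ℝ) : EReal) ∧ z = l • (a - b) := by
    intro z
    rw [← SetLike.mem_coe, hCQ]
    constructor
    · rintro ⟨l, hl, ⟨a, u⟩, hp, ⟨b, v⟩, hq, hz⟩
      exact ⟨l, hl, a, u, _, EReal.le_coe_toReal hp, b, v, _, EReal.le_coe_toReal hq, hz⟩
    · rintro ⟨l, hl, a, u, r, hp, b, v, s, hq, hz⟩
      exact ⟨l, hl, (a, u), ne_top_of_le_ne_top (EReal.coe_ne_top r) hp, (b, v),
        ne_top_of_le_ne_top (EReal.coe_ne_top s) hq, hz⟩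
  have hle : ∀ a u v, F (a, u + v) ≤ F₁ (a, u) + F₂ (a, v) := fun a u v => by
    rw [hFdef]
    exact (iInf_le _ u).trans_eq (by rw [add_sub_cancel_left])
  have hconj_ne_bot : ∀ p, conj2 F p ≠ ⊥ := by
    obtain ⟨l, hl, a, u, r, hu, b, v, s, hv, hz⟩ := (hcq 0).1 V.zero_mem
    obtain rfl : a = b := by simpa [hl.ne', sub_eq_zero, eq_comm] using hz
    intro p hp
    have h := (le_iSup (fun q : X × (X →L[ℝ] ℝ) => ((p.1 q.1 + q.2 p.2 : ℝ) : EReal) - F q)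
      (a, u + v)).trans_eq hp
    have h' : F (a, u + v) ≤ ((r + s : ℝ) : EReal) := (hle a u v).trans (add_le_add hu hv)
    rw [le_bot_iff] at h
    generalize F (a, u + v) = f at h h'
    induction f using EReal.rec with
    | bot => simp at h
    | top => exact absurd h' (EReal.coe_lt_top _).not_ge
    | coe t => exact EReal.coe_ne_bot _ h
  have hstrong : ∀ x x', ∃ y', F₁ (x, y') + F₂ (x, x' - y') ≤ conj2 F (x', x) := by
    intro x x'
    by_cases htop : conj2 F (x', x) = ⊤
    · exact ⟨0, by simp [htop]⟩
    obtain ⟨m, hm⟩ : ∃ m : ℝ, conj2 F (x', x) = m :=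
      ⟨_, (EReal.coe_toReal htop (hconj_ne_bot _)).symm⟩
    obtain ⟨y', p, q, hp, hq, hpq⟩ := (hF₁.selfPolar_epigraph hF₁bot).exists_add_eq
      (hF₂.selfPolar_epigraph hF₂bot) hrefl V hVclosed hcq (x := x) (x' := x') (m := m) (by
        intro a u v r s hu hv
        have h := (le_iSup (fun q : X × (X →L[ℝ] ℝ) => ((x' q.1 + q.2 x : ℝ) : EReal) - F q)
          (a, u + v)).trans_eq hm
        have h' : F (a, u + v) ≤ ((r + s : ℝ) : EReal) := (hle a u v).trans (add_le_add hu hv)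
        generalize F (a, u + v) = f at h h'
        induction f using EReal.rec with
        | bot => simp at h
        | top => exact absurd h' (EReal.coe_lt_top _).not_ge
        | coe t =>
          norm_cast at h h'
          simp only [add_apply] at h
          linarith)
    refine ⟨y', (add_le_add hp hq).trans_eq ?_⟩
    rw [hm, ← hpq, EReal.coe_add]
  have hweak := hF₁.conj2_le_add hF₂ hF₁bot hF₂bot hFdef
  have hauto : Autoconjugate F := by
    intro x x'
    obtain ⟨y', hy'⟩ := hstrong x x'
    refine le_antisymm ?_ ?_
    · rw [hFdef]
      exact le_iInf (hweak x x')
    · rw [hFdef]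
      exact (iInf_le _ y').trans hy'
  have hattained : ∀ x x', ∃ y', F (x, x') = F₁ (x, y') + F₂ (x, x' - y') := by
    intro x x'
    obtain ⟨y', hy'⟩ := hstrong x x'
    rw [← hauto x x']
    exact ⟨y', (hweak x x' y').antisymm hy'⟩
  refine ⟨hauto, fun x x' => ⟨?_, fun h => ?_⟩, hattained⟩
  · rintro ⟨a, ha, b, hb, rfl⟩
    refine le_antisymm ?_ ?_
    · refine (hle x a b).trans_eq ?_
      rw [(hrep₁ x a).1 ha, (hrep₂ x b).1 hb, add_apply, EReal.coe_add]
    · rw [hFdef]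
      refine le_iInf fun y' => ?_
      refine le_trans (le_of_eq ?_)
        (add_le_add (hF₁.pairing_le hF₁bot x y') (hF₂.pairing_le hF₂bot x (a + b - y')))
      rw [← EReal.coe_add, ← add_apply, add_sub_cancel]
  · obtain ⟨y', hy'⟩ := hattained x x'
    have h₁ := hF₁.pairing_le hF₁bot x y'
    have h₂ := hF₂.pairing_le hF₂bot x (x' - y')
    rw [h] at hy'
    obtain ⟨p, q, hp, hq⟩ := exists_coe_of_add_ne_top (hF₁bot (x, y')) (hF₂bot (x, x' - y'))
      (hy' ▸ EReal.coe_ne_top _)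
    rw [hp, EReal.coe_le_coe_iff] at h₁
    rw [hq, EReal.coe_le_coe_iff] at h₂
    rw [hp, hq, ← EReal.coe_add, EReal.coe_eq_coe_iff] at hy'
    have hsub : (x' - y') x = x' x - y' x := rfl
    refine ⟨y', (hrep₁ _ _).2 ?_, x' - y', (hrep₂ _ _).2 ?_, (add_sub_cancel _ _).symm⟩
    · rw [hp, EReal.coe_eq_coe_iff]
      linarith
    · rw [hq, EReal.coe_eq_coe_iff]
      linarith
end
end

section
/- Let A: X → X* be continuous, linear, and monotone. Then the proximal-average based autoconjugate representer ℬ_A satisfies, for every (x,x*) ∈ X×X*: ℬ_A(x,x*) = ⟨x,x*⟩ + q_{A₊}*(x* − Ax); in particular ℬ_A coincides with the Penot–Zălinescu representer 𝒜_A. -/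
noncomputable section
open scoped Classical
open Filter Topology

/-- The Penot–Zălinescu function
`𝒜_A(x,x*) = inf_{y*} (½F_A(x, x*+y*) + ½F_A*(x*-y*, x))`. -/
def pzRep {X : Type*} [NormedAddCommGroup X] [NormedSpace ℝ X]
    (A : X →L[ℝ] X →L[ℝ] ℝ) : X × (X →L[ℝ] ℝ) → EReal :=
  fun p => ⨅ y' : X →L[ℝ] ℝ,
    ((1 / 2 : ℝ) : EReal) * fitz A (p.1, p.2 + y')
      + ((1 / 2 : ℝ) : EReal) * conj2 (fitz A) (p.2 - y', p.1)

/-- The Ghoussoub function `𝒞_A(x,x*) = q_{A₊}(x) + q_{A₊}*(x* - A∘x)`. -/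
def ghoussoub {X : Type*} [NormedAddCommGroup X] [NormedSpace ℝ X]
    (A : X →L[ℝ] X →L[ℝ] ℝ) : X × (X →L[ℝ] ℝ) → EReal :=
  fun p => ((qF (symPart A) p.1 : ℝ) : EReal) + legendre (qF (symPart A)) (p.2 - antiPart A p.1)

/-- The proximal-average based function
`ℬ_A(x,x*) = inf_{(y,y*)} (½F_A(x+y, x*+y*) + ½F_A*(x*-y*, x-y) + ½‖y‖² + ½‖y*‖²)`. -/
def bwRep {X : Type*} [NormedAddCommGroup X] [NormedSpace ℝ X]
    (A : X →L[ℝ] X →L[ℝ] ℝ) : X × (X →L[ℝ] ℝ) → EReal :=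
  fun p => ⨅ q : X × (X →L[ℝ] ℝ),
    ((1 / 2 : ℝ) : EReal) * fitz A (p.1 + q.1, p.2 + q.2)
      + ((1 / 2 : ℝ) : EReal) * conj2 (fitz A) (p.2 - q.2, p.1 - q.1)
      + (((1 / 2) * ‖q.1‖ ^ 2 + (1 / 2) * ‖q.2‖ ^ 2 : ℝ) : EReal)

theorem coe_mul_iSup_coe_add {ι : Sort*} (f : ι → ℝ) {c : ℝ} (hc : 0 < c) (b : ℝ) :
    (c : EReal) * (⨆ i, (f i : EReal)) + (b : EReal) = ⨆ i, ((c * f i + b : ℝ) : EReal) := by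
  have hc0 : (c : EReal) ≠ 0 := EReal.coe_ne_zero.2 hc.ne'
  have hcont : Continuous fun e : EReal => (c : EReal) * e + (b : EReal) := by
    refine continuous_iff_continuousAt.2 fun e => ?_
    have hmul : ContinuousAt (fun e : EReal => (c : EReal) * e) e :=
      ContinuousAt.comp (f := fun e : EReal => ((c : EReal), e))
        (EReal.continuousAt_mul (.inl hc0) (.inl hc0) (.inl (EReal.coe_ne_bot c))
          (.inl (EReal.coe_ne_top c))) (by fun_prop)
    exact ContinuousAt.comp (f := fun e : EReal => ((c : EReal) * e, (b : EReal)))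
      (EReal.continuousAt_add (.inr (EReal.coe_ne_bot b)) (.inr (EReal.coe_ne_top b)))
      (hmul.prodMk continuousAt_const)
  have hmono : Monotone fun e : EReal => (c : EReal) * e + (b : EReal) := fun e e' h =>
    add_le_add_left (mul_le_mul_of_nonneg_left h (by exact_mod_cast hc.le)) _
  have hbot : (c : EReal) * ⊥ + (b : EReal) = ⊥ := by
    rw [EReal.coe_mul_bot_of_pos hc, EReal.bot_add]
  rw [hmono.map_iSup_of_continuousAt hcont.continuousAt hbot]
  simp only [EReal.coe_add, EReal.coe_mul]

section

variable {X : Type*} [NormedAddCommGroup X] [NormedSpace ℝ X]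

theorem qF_symPart (A : X →L[ℝ] X →L[ℝ] ℝ) (x : X) : qF (symPart A) x = (1 / 2) * A x x := by
  simp only [qF, symPart, FunLike.coe_smul, Pi.smul_apply, FunLike.coe_add, Pi.add_apply,
    ContinuousLinearMap.flip_apply, smul_eq_mul]
  ring

theorem half_mul_fitz (A : X →L[ℝ] X →L[ℝ] ℝ) (x : X) (w : X →L[ℝ] ℝ) :
    ((1 / 2 : ℝ) : EReal) * fitz A (x, A x + (2 : ℝ) • w)
      = ((1 / 2 * A x x + w x : ℝ) : EReal) + legendre (qF (symPart A)) w := by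
  have h1 := coe_mul_iSup_coe_add (fun y : X => A y x + (A x + (2 : ℝ) • w) y - A y y)
    (c := 1 / 2) (by norm_num) 0
  have h2 := coe_mul_iSup_coe_add (fun y : X => w y - qF (symPart A) y) one_pos
    (1 / 2 * A x x + w x)
  rw [EReal.coe_zero, add_zero] at h1
  rw [EReal.coe_one, one_mul, add_comm] at h2
  rw [fitz, legendre, h1, h2]
  refine (Equiv.iSup_congr (Equiv.addRight x) fun z => ?_).symm
  congr 1
  simp only [Equiv.coe_addRight, qF_symPart, map_add, FunLike.coe_add, Pi.add_apply,
    FunLike.coe_smul, Pi.smul_apply, smul_eq_mul]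
  ring

theorem conj2_fitz_apply_self (A : X →L[ℝ] X →L[ℝ] ℝ) (hmono : ∀ x : X, 0 ≤ A x x) (x : X) :
    conj2 (fitz A) (A x, x) = ((A x x : ℝ) : EReal) := by
  apply le_antisymm
  · refine iSup_le fun q => ?_
    have h : ((A x q.1 + q.2 x - A x x : ℝ) : EReal) ≤ fitz A q :=
      le_iSup (fun y : X => ((A y q.1 + q.2 y - A y y : ℝ) : EReal)) x
    refine (EReal.sub_le_sub le_rfl h).trans ?_
    rw [← EReal.coe_sub]
    exact EReal.coe_le_coe_iff.2 (by dsimp only; linarith)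
  · refine le_trans ?_ (le_iSup _ (x, A x))
    have h : fitz A (x, A x) ≤ ((A x x : ℝ) : EReal) := by
      refine iSup_le fun y => EReal.coe_le_coe_iff.2 ?_
      have := hmono (y - x)
      simp only [map_sub, FunLike.coe_sub, Pi.sub_apply] at this
      dsimp only
      linarith
    refine le_trans ?_ (EReal.sub_le_sub le_rfl h)
    rw [← EReal.coe_sub]
    exact EReal.coe_le_coe_iff.2 (by dsimp only; linarith)

theorem conj2_fitz_eq_top (A : X →L[ℝ] X →L[ℝ] ℝ) (hmono : ∀ x : X, 0 ≤ A x x)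
    {x : X} {x' : X →L[ℝ] ℝ} (h : x' ≠ A x) : conj2 (fitz A) (x', x) = ⊤ := by
  obtain ⟨z, hz⟩ : ∃ z, x' z - A x z ≠ 0 := by
    by_contra! hcon
    exact h (ContinuousLinearMap.ext fun z => sub_eq_zero.1 (hcon z))
  refine EReal.eq_top_iff_forall_lt _ |>.2 fun r => ?_
  set t : ℝ := (r + 1) / (x' z - A x z)
  have ht : t * x' z - t * A x z = r + 1 := by
    rw [← mul_sub, div_mul_cancel₀ _ hz]
  refine lt_of_lt_of_le ?_ (le_iSup _ (t • z, -A.flip (t • z)))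
  have hF : fitz A (t • z, -A.flip (t • z)) ≤ ((0 : ℝ) : EReal) := by
    refine iSup_le fun y => EReal.coe_le_coe_iff.2 ?_
    simpa [ContinuousLinearMap.flip_apply] using hmono y
  refine lt_of_lt_of_le ?_ (EReal.sub_le_sub le_rfl hF)
  rw [← EReal.coe_sub, EReal.coe_lt_coe_iff]
  simp only [map_smul, FunLike.coe_neg, FunLike.coe_smul, Pi.neg_apply, Pi.smul_apply,
    ContinuousLinearMap.flip_apply, smul_eq_mul]
  linarith

theorem half_mul_fitz_ne_bot (A : X →L[ℝ] X →L[ℝ] ℝ) (x : X) (x' : X →L[ℝ] ℝ) :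
    ((1 / 2 : ℝ) : EReal) * fitz A (x, x') ≠ ⊥ := by
  have h : ((0 : ℝ) : EReal) ≤ fitz A (x, x') :=
    (EReal.coe_le_coe_iff.2 (by simp)).trans
      (le_iSup (fun y : X => ((A y x + x' y - A y y : ℝ) : EReal)) 0)
  have : (0 : EReal) ≤ ((1 / 2 : ℝ) : EReal) * fitz A (x, x') :=
    mul_nonneg (EReal.coe_nonneg.2 (by norm_num)) h
  exact ((EReal.bot_lt_zero).trans_le this).ne'

theorem half_mul_fitz_add_half_mul_conj2_eq_top (A : X →L[ℝ] X →L[ℝ] ℝ)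
    (hmono : ∀ x : X, 0 ≤ A x x) (z : X) (z' : X →L[ℝ] ℝ) {x : X} {x' : X →L[ℝ] ℝ}
    (h : x' ≠ A x) :
    ((1 / 2 : ℝ) : EReal) * fitz A (z, z') + ((1 / 2 : ℝ) : EReal) * conj2 (fitz A) (x', x)
      = ⊤ := by
  rw [conj2_fitz_eq_top A hmono h, EReal.coe_mul_top_of_pos (by norm_num),
    EReal.add_top_of_ne_bot (half_mul_fitz_ne_bot A z z')]

theorem half_mul_fitz_add_half_mul_conj2 (A : X →L[ℝ] X →L[ℝ] ℝ)
    (hmono : ∀ x : X, 0 ≤ A x x) (x y : X) (x' : X →L[ℝ] ℝ) :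
    ((1 / 2 : ℝ) : EReal) * fitz A (x + y, x' + (x' - A x + A y))
        + ((1 / 2 : ℝ) : EReal) * conj2 (fitz A) (x' - (x' - A x + A y), x - y)
      = ((x' x + (A y y + (x' - A x) y) : ℝ) : EReal)
        + legendre (qF (symPart A)) (x' - A x) := by
  have h1 : x' + (x' - A x + A y) = A (x + y) + (2 : ℝ) • (x' - A x) := by
    rw [map_add, two_smul]; abel
  have h2 : x' - (x' - A x + A y) = A (x - y) := by
    rw [map_sub]; abel
  rw [h1, h2, half_mul_fitz, conj2_fitz_apply_self A hmono, add_right_comm, ← EReal.coe_mul,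
    ← EReal.coe_add]
  congr 2
  simp only [map_add, map_sub, FunLike.coe_add, FunLike.coe_sub, Pi.add_apply, Pi.sub_apply]
  ring

theorem pzRep_eq (A : X →L[ℝ] X →L[ℝ] ℝ) (hmono : ∀ x : X, 0 ≤ A x x)
    (x : X) (x' : X →L[ℝ] ℝ) :
    pzRep A (x, x') = ((x' x : ℝ) : EReal) + legendre (qF (symPart A)) (x' - A x) := by
  have h := half_mul_fitz_add_half_mul_conj2 A hmono x 0 x'
  simp only [add_zero, sub_zero, map_zero] at h
  apply le_antisymm
  · exact (iInf_le _ (x' - A x)).trans h.le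
  · refine le_iInf fun y' => ?_
    by_cases hy : x' - y' = A x
    · obtain rfl : y' = x' - A x := by rw [← hy]; abel
      exact h.ge
    · exact le_top.trans (half_mul_fitz_add_half_mul_conj2_eq_top A hmono _ _ hy).ge

/-- The duality gap of the monotone affine map `y ↦ w + A y` against the duality mapping. -/
theorem affine_gap_nonneg (A : X →L[ℝ] X →L[ℝ] ℝ) (w : X →L[ℝ] ℝ) (y : X) :
    0 ≤ A y y + w y + (1 / 2 * ‖y‖ ^ 2 + 1 / 2 * ‖w + A y‖ ^ 2) := by
  have h := (abs_le.1 ((w + A y).le_opNorm y)).1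
  simp only [FunLike.coe_add, Pi.add_apply] at h
  nlinarith [sq_nonneg (‖w + A y‖ - ‖y‖)]

theorem exists_norm_le_apply_eq_sq (u : X) :
    ∃ v : X →L[ℝ] ℝ, ‖v‖ ≤ ‖u‖ ∧ v u = ‖u‖ ^ 2 := by
  obtain ⟨g, hg, hgu⟩ := exists_dual_vector'' ℝ u
  refine ⟨‖u‖ • g, ?_, ?_⟩
  · rw [norm_smul, norm_norm]
    exact mul_le_of_le_one_right (norm_nonneg _) hg
  · simp only [FunLike.coe_smul, Pi.smul_apply, hgu, smul_eq_mul, sq]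
    rfl

theorem convexOn_half_sq_norm_add (E F : Type*) [SeminormedAddCommGroup E] [NormedSpace ℝ E]
    [SeminormedAddCommGroup F] [NormedSpace ℝ F] :
    ConvexOn ℝ Set.univ fun z : E × F => 1 / 2 * ‖z.1‖ ^ 2 + 1 / 2 * ‖z.2‖ ^ 2 := by
  have hE : ConvexOn ℝ Set.univ fun x : E => (1 / 2 : ℝ) * ‖x‖ ^ 2 :=
    (convexOn_univ_norm.pow (fun _ _ => norm_nonneg _) 2).smul (by norm_num)
  have hF : ConvexOn ℝ Set.univ fun x : F => (1 / 2 : ℝ) * ‖x‖ ^ 2 :=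
    (convexOn_univ_norm.pow (fun _ _ => norm_nonneg _) 2).smul (by norm_num)
  exact (hE.comp_linearMap (LinearMap.fst ℝ E F)).add (hF.comp_linearMap (LinearMap.snd ℝ E F))

theorem convex_affine_hypograph (A : X →L[ℝ] X →L[ℝ] ℝ) (hmono : ∀ x : X, 0 ≤ A x x)
    (w : X →L[ℝ] ℝ) (r : ℝ) :
    Convex ℝ {p : (X × (X →L[ℝ] ℝ)) × ℝ |
      p.1.2 = w + A p.1.1 ∧ p.2 ≤ r - (A p.1.1 p.1.1 + w p.1.1)} := by
  rintro ⟨⟨y₁, y₁'⟩, t₁⟩ ⟨h₁', h₁⟩ ⟨⟨y₂, y₂'⟩, t₂⟩ ⟨h₂', h₂⟩ a b ha hb hab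
  obtain rfl : b = 1 - a := by linarith
  dsimp only at h₁ h₁' h₂ h₂'
  subst h₁' h₂'
  constructor
  · ext v
    simp only [Prod.smul_mk, Prod.mk_add_mk, map_add, map_smul, FunLike.coe_add, FunLike.coe_smul,
      Pi.add_apply, Pi.smul_apply, smul_eq_mul]
    ring
  · have h := hmono (y₁ - y₂)
    simp only [map_sub, FunLike.coe_sub, Pi.sub_apply] at h
    simp only [Prod.smul_mk, Prod.mk_add_mk, map_add, map_smul, FunLike.coe_add, FunLike.coe_smul,
      Pi.add_apply, Pi.smul_apply, smul_eq_mul]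
    nlinarith [mul_le_mul_of_nonneg_left h₁ ha, mul_le_mul_of_nonneg_left h₂ hb,
      mul_nonneg (mul_nonneg ha hb) h]

theorem exists_affine_gap_lt
    (hrefl : Function.Surjective (NormedSpace.inclusionInDoubleDual ℝ X))
    (A : X →L[ℝ] X →L[ℝ] ℝ) (hmono : ∀ x : X, 0 ≤ A x x) (w : X →L[ℝ] ℝ)
    {ε : ℝ} (hε : 0 < ε) :
    ∃ y : X, A y y + w y + (1 / 2 * ‖y‖ ^ 2 + 1 / 2 * ‖w + A y‖ ^ 2) < ε := by
  by_contra! hcon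
  let k : X × (X →L[ℝ] ℝ) → ℝ := fun z => 1 / 2 * ‖z.1‖ ^ 2 + 1 / 2 * ‖z.2‖ ^ 2
  have hk : Continuous k := by fun_prop
  have hS : Convex ℝ {p : (X × (X →L[ℝ] ℝ)) × ℝ | k p.1 < p.2} := by
    simpa [k] using (convexOn_half_sq_norm_add X (X →L[ℝ] ℝ)).convex_strict_epigraph
  have hSo : IsOpen {p : (X × (X →L[ℝ] ℝ)) × ℝ | k p.1 < p.2} :=
    isOpen_lt (hk.comp continuous_fst) continuous_snd
  obtain ⟨f, r, hfS, hfT⟩ := geometric_hahn_banach_open hS hSo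
    (convex_affine_hypograph A hmono w ε) (by
      rw [Set.disjoint_left]
      rintro ⟨⟨y, y'⟩, t⟩ hlt ⟨hy', hle⟩
      have := hcon y
      simp only [k, Set.mem_ofPred_eq] at hlt hle hy'
      rw [hy'] at hlt
      linarith)
  let φ : X →L[ℝ] ℝ := f ∘L .inl ℝ _ _ ∘L .inl ℝ _ _
  let ψ : (X →L[ℝ] ℝ) →L[ℝ] ℝ := f ∘L .inl ℝ _ _ ∘L .inr ℝ _ _
  set s : ℝ := f (0, 1)
  have hf (y : X) (y' : X →L[ℝ] ℝ) (t : ℝ) : f ((y, y'), t) = φ y + ψ y' + t * s := by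
    have : ((y, y'), t) = (((y, 0), 0) : (X × (X →L[ℝ] ℝ)) × ℝ) + ((0, y'), 0) + t • (0, 1) := by
      simp
    rw [this, map_add, map_add, map_smul]
    rfl
  replace hfS (y : X) (y' : X →L[ℝ] ℝ) (t : ℝ) (h : k (y, y') < t) :
      φ y + ψ y' + t * s < r := hf y y' t ▸ hfS ((y, y'), t) h
  replace hfT (y : X) : r ≤ φ y + ψ (w + A y) + (ε - (A y y + w y)) * s :=
    hf _ _ _ ▸ hfT ((y, w + A y), ε - (A y y + w y)) ⟨rfl, le_rfl⟩
  have hs : s < 0 := by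
    have h1 := hfS 0 w (k (0, w) + ε + 1) (by linarith)
    have h2 := hfT 0
    have hk0 : 0 ≤ k (0, w) := by positivity
    simp only [map_zero, add_zero, sub_zero] at h1 h2
    nlinarith
  obtain ⟨u, hu⟩ := hrefl ((-s)⁻¹ • ψ)
  have hψ (v : X →L[ℝ] ℝ) : ψ v = -s * v u := by
    have : v u = (-s)⁻¹ * ψ v := by
      have := congrArg (fun g => g v) hu
      rwa [NormedSpace.dual_def] at this
    rw [this, mul_inv_cancel_left₀ (by linarith)]
  obtain ⟨v, hv, hvu⟩ := exists_norm_le_apply_eq_sq u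
  have hkv : k (-u, v) ≤ ‖u‖ ^ 2 := by
    have := pow_le_pow_left₀ (norm_nonneg v) hv 2
    simp only [k, norm_neg]
    linarith
  have h1 := hfS (-u) v (‖u‖ ^ 2 + ε) (by linarith)
  have h2 := hfT (-u)
  rw [hψ] at h1 h2
  simp only [map_neg, FunLike.coe_add, FunLike.coe_neg, Pi.add_apply, Pi.neg_apply] at h1 h2
  rw [hvu] at h1
  nlinarith

theorem bwRep_eq (hrefl : Function.Surjective (NormedSpace.inclusionInDoubleDual ℝ X))
    (A : X →L[ℝ] X →L[ℝ] ℝ) (hmono : ∀ x : X, 0 ≤ A x x) (x : X) (x' : X →L[ℝ] ℝ) :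
    bwRep A (x, x') = ((x' x : ℝ) : EReal) + legendre (qF (symPart A)) (x' - A x) := by
  set w := x' - A x with hw
  set L := legendre (qF (symPart A)) w with hL
  have key (y : X) : ((1 / 2 : ℝ) : EReal) * fitz A (x + y, x' + (w + A y))
        + ((1 / 2 : ℝ) : EReal) * conj2 (fitz A) (x' - (w + A y), x - y)
        + ((1 / 2 * ‖y‖ ^ 2 + 1 / 2 * ‖w + A y‖ ^ 2 : ℝ) : EReal)
      = ((x' x : ℝ) : EReal) + L
        + ((A y y + w y + (1 / 2 * ‖y‖ ^ 2 + 1 / 2 * ‖w + A y‖ ^ 2) : ℝ) : EReal) := by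
    rw [hw, half_mul_fitz_add_half_mul_conj2 A hmono, ← hw, ← hL, EReal.coe_add (x' x),
      EReal.coe_add (A y y + w y)]
    ac_rfl
  apply le_antisymm
  · refine EReal.le_of_forall_lt_iff_le.1 fun z hz => ?_
    have hlt : ((x' x : ℝ) : EReal) + L < (z : EReal) := hz
    have hLt : L ≠ ⊤ := by
      rintro h
      rw [h, EReal.coe_add_top] at hlt
      exact not_top_lt hlt
    have hLb : L ≠ ⊥ := by
      have h : ((0 : ℝ) : EReal) ≤ L := (EReal.coe_le_coe_iff.2 (by simp [qF])).trans
        (le_iSup (fun y : X => ((w y - qF (symPart A) y : ℝ) : EReal)) 0)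
      exact ((EReal.bot_lt_coe 0).trans_le h).ne'
    lift L to ℝ using ⟨hLt, hLb⟩ with l
    have hlt' : x' x + l < z := by exact_mod_cast hlt
    obtain ⟨y, hy⟩ := exists_affine_gap_lt hrefl A hmono w (sub_pos.2 hlt')
    refine (iInf_le _ (y, w + A y)).trans ((key y).le.trans ?_)
    rw [← EReal.coe_add, ← EReal.coe_add, EReal.coe_le_coe_iff]
    linarith
  · refine le_iInf fun ⟨y, y'⟩ => ?_
    by_cases hy : x' - y' = A (x - y)
    · obtain rfl : y' = w + A y := by
        have h := sub_eq_iff_eq_add.1 hy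
        rw [hw, h, map_sub]; abel
      refine le_trans ?_ (key y).ge
      exact le_add_of_nonneg_right (EReal.coe_nonneg.2 (affine_gap_nonneg A w y))
    · dsimp only
      rw [half_mul_fitz_add_half_mul_conj2_eq_top A hmono _ _ hy, EReal.top_add_coe]
      exact le_top

end

/-- Theorem 3.1, Claim 3. For `A : X → X*` continuous, linear and
monotone, `ℬ_A(x,x*) = ⟨x,x*⟩ + q_{A₊}*(x* - Ax)`; in particular `ℬ_A = 𝒜_A`. -/
theorem stmt9 {X : Type*} [NormedAddCommGroup X] [NormedSpace ℝ X] [CompleteSpace X]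
    (hrefl : Function.Surjective (NormedSpace.inclusionInDoubleDual ℝ X))
    (A : X →L[ℝ] X →L[ℝ] ℝ)
    (hmono : ∀ x : X, 0 ≤ A x x) :
    (∀ (x : X) (x' : X →L[ℝ] ℝ),
      bwRep A (x, x') = ((x' x : ℝ) : EReal) + legendre (qF (symPart A)) (x' - A x)) ∧
    bwRep A = pzRep A := by
  have h := bwRep_eq hrefl A hmono
  exact ⟨h, funext fun ⟨x, x'⟩ => (h x x').trans (pzRep_eq A hmono x x').symm⟩
end
end

section
/- Let f: ℝ → (−∞,+∞] be the negative logarithm: f(x) = −ln x for x > 0 and f(x) = +∞ for x ≤ 0, and let ∂f be its subdifferential. Then: dom 𝒜_{∂f} = {(x,x*) ∈ ℝ² : x* ≤ −1/(2x) < 0}, dom ℬ_{∂f} = {(x,x*) ∈ ℝ² : x* ≤ −1/(4x) < 0}, and dom(f ⊕ f*) = (0,+∞) × (−∞,0). Consequently, 𝒜_{∂f}, ℬ_{∂f}, and f ⊕ f* are three pairwise distinct autoconjugate representers for ∂f. -/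
noncomputable section
open scoped Classical

/-- The Fenchel conjugate of `g : ℝ → (-∞,+∞]`: `g*(y) = sup_x (xy - g(x))`. -/
def rconj (g : ℝ → EReal) : ℝ → EReal :=
  fun y => ⨆ x : ℝ, ((x * y : ℝ) : EReal) - g x

/-- The Fenchel conjugate of `F : ℝ × ℝ → (-∞,+∞]`, as a function on `ℝ × ℝ` (dual pair
first): `F*(x*,x) = sup_{(y,y*)} (y x* + x y* - F(y,y*))`. -/
def rconj2 (F : ℝ × ℝ → EReal) : ℝ × ℝ → EReal :=
  fun p => ⨆ q : ℝ × ℝ, ((q.1 * p.1 + p.2 * q.2 : ℝ) : EReal) - F q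

/-- The negative natural logarithm `f(x) = -ln x` for `x > 0`, `+∞` otherwise. -/
def negLog : ℝ → EReal :=
  fun x => if 0 < x then ((-Real.log x : ℝ) : EReal) else ⊤

/-- The subdifferential of `f : ℝ → (-∞,+∞]`. -/
def rsubdiff (f : ℝ → EReal) : ℝ → Set ℝ :=
  fun x => {x' | ∀ y : ℝ, (((y - x) * x' : ℝ) : EReal) + f x ≤ f y}

/-- The Fitzpatrick function of a set-valued `A : ℝ ⇉ ℝ`:
`F_A(x,x*) = sup_{(y,y*) ∈ gra A} (x y* + y x* - y y*)`. -/
def rfitz (A : ℝ → Set ℝ) : ℝ × ℝ → EReal :=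
  fun p => ⨆ q : ℝ × ℝ, ⨆ _ : q.2 ∈ A q.1,
    ((p.1 * q.2 + q.1 * p.2 - q.1 * q.2 : ℝ) : EReal)

/-- The Penot–Zălinescu function `𝒜_A(x,x*) = inf_{y*} (½F_A(x,x*+y*) + ½F_A*(x*-y*,x))`. -/
def rpz (A : ℝ → Set ℝ) : ℝ × ℝ → EReal :=
  fun p => ⨅ y' : ℝ,
    ((1 / 2 : ℝ) : EReal) * rfitz A (p.1, p.2 + y')
      + ((1 / 2 : ℝ) : EReal) * rconj2 (rfitz A) (p.2 - y', p.1)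

/-- The proximal-average based function
`ℬ_A(x,x*) = inf_{(y,y*)} (½F_A(x+y,x*+y*) + ½F_A*(x*-y*,x-y) + ½y² + ½y*²)`. -/
def rbw (A : ℝ → Set ℝ) : ℝ × ℝ → EReal :=
  fun p => ⨅ q : ℝ × ℝ,
    ((1 / 2 : ℝ) : EReal) * rfitz A (p.1 + q.1, p.2 + q.2)
      + ((1 / 2 : ℝ) : EReal) * rconj2 (rfitz A) (p.2 - q.2, p.1 - q.1)
      + ((1 / 2 * q.1 ^ 2 + 1 / 2 * q.2 ^ 2 : ℝ) : EReal)

/-- `F` is autoconjugate (on `ℝ × ℝ`). -/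
def rAutoconjugate (F : ℝ × ℝ → EReal) : Prop :=
  ∀ x x' : ℝ, rconj2 F (x', x) = F (x, x')

/-- `F` is a representer for `A : ℝ ⇉ ℝ`. -/
def rIsRepresenter (F : ℝ × ℝ → EReal) (A : ℝ → Set ℝ) : Prop :=
  ∀ x x' : ℝ, x' ∈ A x ↔ F (x, x') = ((x * x' : ℝ) : EReal)

theorem half_mul_top : ((1 / 2 : ℝ) : EReal) * ⊤ = ⊤ :=
  EReal.coe_mul_top_of_pos (by norm_num)

theorem coe_le_rconj2 {F : ℝ × ℝ → EReal} {p : ℝ × ℝ} {r : ℝ} (q : ℝ × ℝ)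
    (h : F q ≤ ((q.1 * p.1 + p.2 * q.2 - r : ℝ) : EReal)) : (r : EReal) ≤ rconj2 F p := by
  refine le_trans ?_ (le_iSup _ q)
  generalize F q = e at h
  induction e using EReal.rec with
  | bot => rw [EReal.coe_sub_bot]; exact le_top
  | top => exact absurd (top_le_iff.1 h) (EReal.coe_ne_top _)
  | coe e => norm_cast at h ⊢; linarith

theorem rconj2_le_coe {F : ℝ × ℝ → EReal} {p : ℝ × ℝ} {r : ℝ}
    (h : ∀ q : ℝ × ℝ, ((q.1 * p.1 + p.2 * q.2 - r : ℝ) : EReal) ≤ F q) :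
    rconj2 F p ≤ (r : EReal) := by
  refine iSup_le fun q => ?_
  have hq := h q
  generalize F q = e at hq
  induction e using EReal.rec with
  | bot => exact absurd (le_bot_iff.1 hq) (EReal.coe_ne_bot _)
  | top => simp
  | coe e => norm_cast at hq ⊢; linarith

theorem eq_top_of_forall_coe_le {e : EReal} (h : ∀ r : ℝ, (r : EReal) ≤ e) : e = ⊤ := by
  refine EReal.eq_top_iff_forall_lt e |>.2 fun r => lt_of_lt_of_le ?_ (h (r + 1))
  exact_mod_cast lt_add_one r

theorem two_mul_sqrt_le {a b c d : ℝ} (ha : 0 ≤ a) (hb : 0 ≤ b) (hc : 0 < c) (hcd : 1 ≤ c * d) :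
    2 * √(a * b) ≤ a * d + b * c := by
  have hd : 0 < d := by by_contra! h; nlinarith
  have h1 : 0 ≤ a * d := by positivity
  have h2 : 0 ≤ b * c := by positivity
  have h : √(a * b) ≤ (a * d + b * c) / 2 := by
    refine Real.sqrt_le_iff.2 ⟨by linarith, ?_⟩
    nlinarith [sq_nonneg (a * d - b * c), mul_le_mul_of_nonneg_left hcd (mul_nonneg ha hb)]
  linarith

theorem exists_mul_eq_one_add_lt_two {x s : ℝ} (h : ¬(0 < x ∧ 1 ≤ x * s)) :
    ∃ m n : ℝ, 0 < m ∧ 0 < n ∧ m * n = 1 ∧ m * s + n * x < 2 := by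
  by_cases hx : 0 < x
  · have hs : x * s < 1 := by by_contra! h'; exact h ⟨hx, h'⟩
    refine ⟨x, x⁻¹, hx, by positivity, by field_simp, ?_⟩
    rw [inv_mul_cancel₀ hx.ne']
    linarith
  · have hn : 0 < |s| + 1 := by positivity
    refine ⟨(|s| + 1)⁻¹, |s| + 1, by positivity, hn, by field_simp, ?_⟩
    have h1 : (|s| + 1)⁻¹ * s ≤ 1 := by
      rw [inv_mul_le_iff₀ hn]; linarith [le_abs_self s]
    nlinarith

/-! ### The subdifferential and the Fitzpatrick function of the negative logarithm -/

theorem mem_rsubdiff_negLog {x x' : ℝ} :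
    x' ∈ rsubdiff negLog x ↔ 0 < x ∧ x * x' = -1 := by
  constructor
  · intro h
    have hx : 0 < x := by
      by_contra hx
      have := h 1
      rw [negLog, if_neg hx, EReal.coe_add_top, negLog, if_pos one_pos] at this
      exact absurd (top_le_iff.1 this) (EReal.coe_ne_top _)
    refine ⟨hx, ?_⟩
    have key : ∀ t : ℝ, 0 < t → Real.log t + (t - 1) * (x * x') ≤ 0 := by
      intro t ht
      have := h (x * t)
      simp only [negLog, hx, mul_pos hx ht, if_true] at this
      norm_cast at this
      rw [Real.log_mul hx.ne' ht.ne'] at this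
      linarith
    have hmax : IsLocalMax (fun t : ℝ => Real.log t + (t - 1) * (x * x')) 1 := by
      filter_upwards [lt_mem_nhds (zero_lt_one' ℝ)] with t ht
      simpa using key t ht
    have hder : HasDerivAt (fun t : ℝ => Real.log t + (t - 1) * (x * x'))
        (1⁻¹ + 1 * (x * x')) 1 :=
      (Real.hasDerivAt_log one_ne_zero).add (((hasDerivAt_id 1).sub_const 1).mul_const _)
    have := hmax.hasDerivAt_eq_zero hder
    linarith
  · rintro ⟨hx, h⟩ y
    by_cases hy : 0 < y
    · simp only [negLog, hx, hy, if_true]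
      norm_cast
      have h1 := Real.log_le_sub_one_of_pos (div_pos hy hx)
      rw [Real.log_div hy.ne' hx.ne'] at h1
      have h2 : y / x = -(y * x') := by
        rw [div_eq_iff hx.ne']; linear_combination y * h
      linarith
    · simp [negLog, hy]

theorem le_rfitz_negLog {p : ℝ × ℝ} {y w : ℝ} (hy : 0 < y) (hyw : y * w = 1) :
    ((1 - (p.1 * w - y * p.2) : ℝ) : EReal) ≤ rfitz (rsubdiff negLog) p := by
  refine le_trans (le_of_eq ?_) (le_iSup₂ (y, -w)
    (mem_rsubdiff_negLog.2 ⟨hy, by simp only; linarith⟩))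
  norm_cast
  linear_combination -hyw

theorem rfitz_negLog (p : ℝ × ℝ) : rfitz (rsubdiff negLog) p =
    if 0 ≤ p.1 ∧ p.2 ≤ 0 then ((1 - 2 * √(p.1 * -p.2) : ℝ) : EReal) else ⊤ := by
  split_ifs with h
  · obtain ⟨hx, hs⟩ := h
    apply le_antisymm
    · refine iSup₂_le fun q hq => ?_
      obtain ⟨h1, h2⟩ := mem_rsubdiff_negLog.1 hq
      norm_cast
      have := two_mul_sqrt_le hx (neg_nonneg.2 hs) h1 (d := -q.2) (by linarith)
      linarith
    · have hlim : Filter.Tendsto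
          (fun ε : ℝ => ((1 - 2 * √((p.1 + ε) * (-p.2 + ε)) : ℝ) : EReal))
          (nhdsWithin 0 (Set.Ioi 0)) (nhds ((1 - 2 * √(p.1 * -p.2) : ℝ) : EReal)) := by
        have hc : Continuous
            (fun ε : ℝ => ((1 - 2 * √((p.1 + ε) * (-p.2 + ε)) : ℝ) : EReal)) :=
          continuous_coe_real_ereal.comp (by fun_prop)
        simpa using (hc.tendsto 0).mono_left nhdsWithin_le_nhds
      refine le_of_tendsto hlim ?_
      filter_upwards [self_mem_nhdsWithin] with ε (hε : 0 < ε)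
      have ha : 0 < p.1 + ε := by linarith
      have hb : 0 < -p.2 + ε := by linarith
      have hsa := Real.sqrt_pos.2 ha
      have hsb := Real.sqrt_pos.2 hb
      have h1 := Real.mul_self_sqrt ha.le
      have h2 := Real.mul_self_sqrt hb.le
      refine le_trans ?_ (le_rfitz_negLog (y := √(p.1 + ε) / √(-p.2 + ε))
        (w := √(-p.2 + ε) / √(p.1 + ε)) (by positivity) (by field_simp))
      norm_cast
      rw [Real.sqrt_mul ha.le]
      have e1 : (p.1 + ε) * (√(-p.2 + ε) / √(p.1 + ε)) = √(p.1 + ε) * √(-p.2 + ε) := by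
        field_simp; linear_combination -h1
      have e2 : √(p.1 + ε) / √(-p.2 + ε) * (-p.2 + ε) = √(p.1 + ε) * √(-p.2 + ε) := by
        field_simp; linear_combination -h2
      have g1 : 0 < ε * (√(-p.2 + ε) / √(p.1 + ε)) := by positivity
      have g2 : 0 < √(p.1 + ε) / √(-p.2 + ε) * ε := by positivity
      linarith
  · refine eq_top_of_forall_coe_le fun r => ?_
    by_cases hx : 0 ≤ p.1
    · have hs : 0 < p.2 := by by_contra! hs; exact h ⟨hx, hs⟩
      have hN : 1 ≤ 1 + (|r| + p.1) / p.2 := le_add_of_nonneg_right (by positivity)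
      have hw := inv_le_one_of_one_le₀ hN
      refine le_trans ?_ (le_rfitz_negLog (zero_lt_one.trans_le hN)
        (mul_inv_cancel₀ (zero_lt_one.trans_le hN).ne'))
      norm_cast
      have e : (1 + (|r| + p.1) / p.2) * p.2 = p.2 + (|r| + p.1) := by field_simp
      rw [e]
      nlinarith [le_abs_self r]
    · have hx : 0 < -p.1 := by linarith
      have hN : 1 ≤ 1 + (|r| + |p.2|) / -p.1 := le_add_of_nonneg_right (by positivity)
      have hw := inv_le_one_of_one_le₀ hN
      have hw0 := inv_pos.2 (zero_lt_one.trans_le hN)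
      refine le_trans ?_ (le_rfitz_negLog hw0
        (inv_mul_cancel₀ (zero_lt_one.trans_le hN).ne'))
      norm_cast
      have e : -p.1 * (1 + (|r| + |p.2|) / -p.1) = -p.1 + (|r| + |p.2|) := by
        rw [mul_add, mul_div_cancel₀ _ hx.ne', mul_one]
      have := neg_abs_le p.2
      have := abs_nonneg p.2
      nlinarith [le_abs_self r]

theorem rconj2_rfitz_negLog (p : ℝ × ℝ) : rconj2 (rfitz (rsubdiff negLog)) p =
    if 0 < p.2 ∧ 1 ≤ p.2 * -p.1 then ((-1 : ℝ) : EReal) else ⊤ := by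
  split_ifs with h
  · obtain ⟨hx, hs⟩ := h
    apply le_antisymm
    · refine rconj2_le_coe fun q => ?_
      rw [rfitz_negLog]
      split_ifs with hq
      · have := two_mul_sqrt_le hq.1 (neg_nonneg.2 hq.2) hx hs
        exact EReal.coe_le_coe_iff.2 (by linarith)
      · exact le_top
    · refine coe_le_rconj2 0 ?_
      rw [rfitz_negLog]
      simp
  · obtain ⟨m, n, hm, hn, hmn, hlt⟩ := exists_mul_eq_one_add_lt_two h
    refine eq_top_of_forall_coe_le fun r => ?_
    set δ := 2 - (m * -p.1 + n * p.2) with hδ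
    have hδ0 : 0 < δ := by linarith
    have hκ : 0 ≤ (|r| + 1) / δ := by positivity
    refine coe_le_rconj2 ((|r| + 1) / δ * m, -((|r| + 1) / δ * n)) ?_
    rw [rfitz_negLog, if_pos ⟨by positivity, by simp only [neg_nonpos]; positivity⟩]
    have e : (|r| + 1) / δ * m * - -((|r| + 1) / δ * n) = ((|r| + 1) / δ) ^ 2 := by
      linear_combination ((|r| + 1) / δ) ^ 2 * hmn
    simp only [e, Real.sqrt_sq hκ]
    norm_cast
    have e2 : (|r| + 1) / δ * δ = |r| + 1 := by field_simp
    rw [hδ] at e2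
    nlinarith [le_abs_self r]

theorem half_rfitz_add_half_rconj2 (p q : ℝ × ℝ) :
    ((1 / 2 : ℝ) : EReal) * rfitz (rsubdiff negLog) p
      + ((1 / 2 : ℝ) : EReal) * rconj2 (rfitz (rsubdiff negLog)) q =
    if (0 ≤ p.1 ∧ p.2 ≤ 0) ∧ 0 < q.2 ∧ 1 ≤ q.2 * -q.1 then
      ((-√(p.1 * -p.2) : ℝ) : EReal) else ⊤ := by
  rw [rfitz_negLog, rconj2_rfitz_negLog]
  by_cases h1 : 0 ≤ p.1 ∧ p.2 ≤ 0 <;> by_cases h2 : 0 < q.2 ∧ 1 ≤ q.2 * -q.1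
  · rw [if_pos h1, if_pos h2, if_pos ⟨h1, h2⟩, ← EReal.coe_mul, ← EReal.coe_mul,
      ← EReal.coe_add, EReal.coe_eq_coe_iff]
    ring
  · rw [if_pos h1, if_neg h2, if_neg (fun h => h2 h.2), half_mul_top, ← EReal.coe_mul,
      EReal.coe_add_top]
  · rw [if_neg h1, if_pos h2, if_neg (fun h => h1 h.1), half_mul_top, ← EReal.coe_mul,
      EReal.top_add_coe]
  · rw [if_neg h1, if_neg h2, if_neg (fun h => h1 h.1), half_mul_top, EReal.top_add_top]

/-! ### The separable representer `f ⊕ f*` -/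

theorem rconj_negLog (y : ℝ) :
    rconj negLog y = if y < 0 then ((-1 - Real.log (-y) : ℝ) : EReal) else ⊤ := by
  have hterm : ∀ x : ℝ, 0 < x →
      ((x * y : ℝ) : EReal) - negLog x = ((x * y + Real.log x : ℝ) : EReal) := by
    intro x hx
    rw [negLog, if_pos hx, ← EReal.coe_sub, sub_neg_eq_add]
  split_ifs with hy
  · have hy' : 0 < -y := by linarith
    apply le_antisymm
    · refine iSup_le fun x => ?_
      by_cases hx : 0 < x
      · rw [hterm x hx, EReal.coe_le_coe_iff]
        have := Real.log_le_sub_one_of_pos (mul_pos hx hy')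
        rw [Real.log_mul hx.ne' hy'.ne'] at this
        linarith
      · rw [negLog, if_neg hx, EReal.sub_top]
        exact bot_le
    · refine le_trans (le_of_eq ?_) (le_iSup _ (-y)⁻¹)
      rw [hterm _ (inv_pos.2 hy'), EReal.coe_eq_coe_iff, Real.log_inv]
      have e : (-y)⁻¹ * y = -1 := by rw [inv_neg, neg_mul, inv_mul_cancel₀ hy.ne]
      rw [e]
      ring
  · refine eq_top_of_forall_coe_le fun r => ?_
    refine le_trans ?_ (le_iSup _ (Real.exp |r|))
    rw [hterm _ (Real.exp_pos _), EReal.coe_le_coe_iff, Real.log_exp]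
    have := mul_nonneg (Real.exp_pos |r|).le (not_lt.1 hy)
    linarith [le_abs_self r]

theorem negLog_add_rconj_negLog (x x' : ℝ) : negLog x + rconj negLog x' =
    if 0 < x ∧ x' < 0 then ((-1 - Real.log x - Real.log (-x') : ℝ) : EReal) else ⊤ := by
  rw [rconj_negLog, negLog]
  by_cases h1 : 0 < x <;> by_cases h2 : x' < 0
  · rw [if_pos h1, if_pos h2, if_pos ⟨h1, h2⟩, ← EReal.coe_add, EReal.coe_eq_coe_iff]
    ring
  · rw [if_pos h1, if_neg h2, if_neg (fun h => h2 h.2), EReal.coe_add_top]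
  · rw [if_neg h1, if_pos h2, if_neg (fun h => h1 h.1), EReal.top_add_coe]
  · rw [if_neg h1, if_neg h2, if_neg (fun h => h1 h.1), EReal.top_add_top]

theorem rAutoconjugate_negLog_add_rconj :
    rAutoconjugate (fun p : ℝ × ℝ => negLog p.1 + rconj negLog p.2) := by
  intro x x'
  simp only [negLog_add_rconj_negLog]
  split_ifs with h
  · obtain ⟨hx, hx'⟩ := h
    have hs : 0 < -x' := by linarith
    apply le_antisymm
    · refine rconj2_le_coe fun q => ?_
      split_ifs with hq
      · have hq2 : 0 < -q.2 := by linarith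
        have h1 := Real.log_le_sub_one_of_pos (mul_pos hq.1 hs)
        have h2 := Real.log_le_sub_one_of_pos (mul_pos hx hq2)
        rw [Real.log_mul hq.1.ne' hs.ne'] at h1
        rw [Real.log_mul hx.ne' hq2.ne'] at h2
        exact EReal.coe_le_coe_iff.2 (by simp only; linarith)
      · exact le_top
    · refine coe_le_rconj2 ((-x')⁻¹, -x⁻¹) ?_
      rw [if_pos ⟨inv_pos.2 hs, neg_lt_zero.2 (inv_pos.2 hx)⟩,
        EReal.coe_le_coe_iff]
      simp only [neg_neg, Real.log_inv]
      have e1 : (-x')⁻¹ * x' = -1 := by rw [inv_neg, neg_mul, inv_mul_cancel₀ hx'.ne]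
      have e2 : x * -x⁻¹ = -1 := by field_simp
      linarith
  · refine eq_top_of_forall_coe_le fun r => ?_
    have hexp := Real.add_one_le_exp |r|
    by_cases hx : 0 < x
    · have hx' : 0 ≤ x' := by by_contra! hx'; exact h ⟨hx, hx'⟩
      refine coe_le_rconj2 (Real.exp (|r| + x), -1) ?_
      rw [if_pos ⟨Real.exp_pos _, by norm_num⟩, EReal.coe_le_coe_iff]
      simp only [neg_neg, Real.log_one, Real.log_exp]
      have := mul_nonneg (Real.exp_pos (|r| + x)).le hx'
      linarith [le_abs_self r]
    · refine coe_le_rconj2 (1, -Real.exp (|r| + |x'|)) ?_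
      rw [if_pos ⟨one_pos, neg_lt_zero.2 (Real.exp_pos _)⟩,
        EReal.coe_le_coe_iff]
      simp only [neg_neg, Real.log_one, Real.log_exp]
      have := mul_nonneg (Real.exp_pos (|r| + |x'|)).le (neg_nonneg.2 (not_lt.1 hx))
      linarith [le_abs_self r, neg_abs_le x']

theorem rIsRepresenter_negLog_add_rconj :
    rIsRepresenter (fun p : ℝ × ℝ => negLog p.1 + rconj negLog p.2) (rsubdiff negLog) := by
  intro x x'
  simp only [mem_rsubdiff_negLog, negLog_add_rconj_negLog]
  constructor
  · rintro ⟨hx, h⟩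
    have hs : 0 < -x' := by by_contra! h'; nlinarith
    rw [if_pos ⟨hx, neg_pos.1 hs⟩, EReal.coe_eq_coe_iff, h, sub_sub,
      ← Real.log_mul hx.ne' hs.ne', show x * -x' = 1 by linarith]
    simp
  · intro h
    split_ifs at h with hd
    · obtain ⟨hx, hx'⟩ := hd
      have hs : 0 < -x' := by linarith
      refine ⟨hx, ?_⟩
      rw [EReal.coe_eq_coe_iff, sub_sub, ← Real.log_mul hx.ne' hs.ne'] at h
      by_contra hne
      have := Real.log_lt_sub_one_of_pos (mul_pos hx hs) (fun h1 => hne (by linarith))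
      linarith
    · exact absurd h.symm (EReal.coe_ne_top _)

/-! ### The representer `𝒜` -/

theorem rpz_negLog (p : ℝ × ℝ) : rpz (rsubdiff negLog) p =
    if 0 < p.1 ∧ 1 ≤ 2 * (p.1 * -p.2) then
      ((-√(2 * (p.1 * -p.2) - 1) : ℝ) : EReal) else ⊤ := by
  simp only [rpz, half_rfitz_add_half_rconj2]
  split_ifs with h
  · obtain ⟨hx, h1⟩ := h
    have hinv : p.1 * p.1⁻¹ = 1 := mul_inv_cancel₀ hx.ne'
    apply le_antisymm
    · refine (iInf_le _ (p.2 + p.1⁻¹)).trans (le_of_eq ?_)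
      rw [if_pos]
      · rw [show p.1 * -(p.2 + (p.2 + p.1⁻¹)) = 2 * (p.1 * -p.2) - 1 by
          linear_combination -hinv]
      · refine ⟨⟨hx.le, ?_⟩, hx, ?_⟩
        · by_contra! h2
          nlinarith [mul_pos hx h2]
        · linarith
    · refine le_iInf fun y' => ?_
      split_ifs with hq
      · rw [EReal.coe_le_coe_iff, neg_le_neg_iff]
        exact Real.sqrt_le_sqrt (by linarith [hq.2.2])
      · exact le_top
  · refine iInf_eq_top.2 fun y' => if_neg ?_
    rintro ⟨⟨h1, h2⟩, h3, h4⟩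
    exact h ⟨h3, by nlinarith [mul_nonneg h1 (neg_nonneg.2 h2)]⟩

theorem rAutoconjugate_rpz_negLog : rAutoconjugate (rpz (rsubdiff negLog)) := by
  intro x x'
  rw [rpz_negLog]
  split_ifs with h
  · obtain ⟨hx : 0 < x, h1 : 1 ≤ 2 * (x * -x')⟩ := h
    have hs : 0 < -x' := by by_contra! h'; nlinarith
    apply le_antisymm
    · refine rconj2_le_coe fun q => ?_
      rw [rpz_negLog]
      split_ifs with hq
      · rw [EReal.coe_le_coe_iff]
        simp only
        obtain ⟨ha, hb⟩ := hq
        have hb' : 0 < -q.2 := by by_contra! h'; nlinarith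
        set v := √(2 * (x * -x') - 1)
        set w := √(2 * (q.1 * -q.2) - 1)
        have hv : v ^ 2 = 2 * (x * -x') - 1 := Real.sq_sqrt (by linarith)
        have hw : w ^ 2 = 2 * (q.1 * -q.2) - 1 := Real.sq_sqrt (by linarith)
        have hpos : 0 ≤ q.1 * -x' + x * -q.2 := by positivity
        have : w + v ≤ q.1 * -x' + x * -q.2 := by
          refine le_of_sq_le_sq ?_ hpos
          nlinarith [sq_nonneg (v * w - 1), sq_nonneg (q.1 * -x' - x * -q.2)]
        linarith
      · exact le_top
    · rcases h1.eq_or_lt with h1 | h1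
      · have hlim : Filter.Tendsto (fun κ : ℝ => ((-κ⁻¹ : ℝ) : EReal)) Filter.atTop
            (nhds ((-0 : ℝ) : EReal)) :=
          (continuous_coe_real_ereal.tendsto _).comp tendsto_inv_atTop_zero.neg
        simp only [← h1, sub_self, Real.sqrt_zero]
        refine le_of_tendsto hlim ?_
        filter_upwards [Filter.eventually_ge_atTop 1] with κ hκ
        have hκ0 : 0 < κ := by linarith
        have e : 2 * (κ * x * (κ * -x')) - 1 = κ ^ 2 - 1 := by
          linear_combination -κ ^ 2 * h1
        refine coe_le_rconj2 (κ * x, κ * x') ?_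
        rw [rpz_negLog, if_pos, EReal.coe_le_coe_iff]
        · simp only [← mul_neg, e]
          have : κ - κ⁻¹ ≤ √(κ ^ 2 - 1) := by
            refine Real.le_sqrt_of_sq_le ?_
            have e2 : κ * κ⁻¹ = 1 := mul_inv_cancel₀ hκ0.ne'
            nlinarith [inv_le_one_of_one_le₀ hκ, inv_pos.2 hκ0]
          linear_combination this - κ * h1
        · refine ⟨by positivity, ?_⟩
          simp only [← mul_neg]
          nlinarith
      · set v := √(2 * (x * -x') - 1) with hvdef
        have hv : v ^ 2 = 2 * (x * -x') - 1 := Real.sq_sqrt (by linarith)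
        have hv0 : 0 < v := Real.sqrt_pos.2 (by linarith)
        have e : 2 * (v⁻¹ * x * (v⁻¹ * -x')) - 1 = v⁻¹ ^ 2 := by
          field_simp
          linarith
        refine coe_le_rconj2 (v⁻¹ * x, v⁻¹ * x') ?_
        rw [rpz_negLog, if_pos, EReal.coe_le_coe_iff]
        · simp only [← mul_neg, e, Real.sqrt_sq (inv_pos.2 hv0).le]
          have e2 : v⁻¹ * (v ^ 2 + 1 - 1) = v := by field_simp; ring
          rw [hv] at e2
          linarith
        · refine ⟨by positivity, ?_⟩
          simp only [← mul_neg]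
          nlinarith [sq_nonneg v⁻¹]
  · refine eq_top_of_forall_coe_le fun r => ?_
    obtain ⟨m, n, hm, hn, hmn, hlt⟩ := exists_mul_eq_one_add_lt_two (x := 2 * x) (s := -x')
      (fun h' => h ⟨by linarith [h'.1], by simp only; linarith [h'.2]⟩)
    set δ := 1 - (m * -x' / 2 + n * x) with hδ
    have hδ0 : 0 < δ := by linarith
    have hκ : 1 ≤ 1 + (|r| + 1) / δ := le_add_of_nonneg_right (by positivity)
    have hκδ : (1 + (|r| + 1) / δ) * δ = δ + (|r| + 1) := by field_simp
    set κ := 1 + (|r| + 1) / δ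
    have e : 2 * (κ * (m / 2) * (κ * n)) - 1 = κ ^ 2 - 1 := by
      linear_combination κ ^ 2 * hmn
    refine coe_le_rconj2 (κ * (m / 2), -(κ * n)) ?_
    rw [rpz_negLog, if_pos, EReal.coe_le_coe_iff]
    · simp only [neg_neg, e]
      have : κ - 1 ≤ √(κ ^ 2 - 1) := Real.le_sqrt_of_sq_le (by nlinarith)
      nlinarith [le_abs_self r]
    · refine ⟨by positivity, ?_⟩
      simp only [neg_neg]
      nlinarith

theorem rIsRepresenter_rpz_negLog :
    rIsRepresenter (rpz (rsubdiff negLog)) (rsubdiff negLog) := by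
  intro x x'
  rw [mem_rsubdiff_negLog, rpz_negLog]
  constructor
  · rintro ⟨hx, h⟩
    have h1 : 2 * (x * -x') - 1 = 1 := by linarith
    rw [if_pos ⟨hx, by simp only; linarith⟩, EReal.coe_eq_coe_iff, h1, h, Real.sqrt_one]
  · intro h
    split_ifs at h with hd
    · obtain ⟨hx : 0 < x, hd : 1 ≤ 2 * (x * -x')⟩ := hd
      refine ⟨hx, ?_⟩
      rw [EReal.coe_eq_coe_iff] at h
      have hsq := Real.sq_sqrt (show 0 ≤ 2 * (x * -x') - 1 by linarith)
      rw [show √(2 * (x * -x') - 1) = -(x * x') by linarith] at hsq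
      have : (x * x' + 1) ^ 2 = 0 := by linear_combination hsq
      linarith [pow_eq_zero_iff two_ne_zero |>.1 this]
    · exact absurd h.symm (EReal.coe_ne_top _)

/-! ### The representer `ℬ` -/

theorem le_rbw_negLog {p : ℝ × ℝ} {e : EReal}
    (h : ∀ a b c d : ℝ, 0 ≤ a → 0 ≤ b → 0 < c → 1 ≤ c * d → a + c = 2 * p.1 →
      b + d = -(2 * p.2) →
      e ≤ ((-√(a * b) + (1 / 2 * (p.1 - c) ^ 2 + 1 / 2 * (p.2 + d) ^ 2) : ℝ) : EReal)) :
    e ≤ rbw (rsubdiff negLog) p := by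
  simp only [rbw, half_rfitz_add_half_rconj2]
  refine le_iInf fun q => ?_
  split_ifs with hq
  · obtain ⟨⟨ha, hb⟩, hc, hcd⟩ := hq
    refine (h _ _ _ _ ha (neg_nonneg.2 hb) hc hcd (by ring) (by ring)).trans (le_of_eq ?_)
    rw [← EReal.coe_add, EReal.coe_eq_coe_iff]
    ring_nf
  · rw [EReal.top_add_coe]
    exact le_top

theorem rbw_negLog_le {p : ℝ × ℝ} {a b c d : ℝ} (ha : 0 ≤ a) (hb : 0 ≤ b) (hc : 0 < c)
    (hcd : 1 ≤ c * d) (hac : a + c = 2 * p.1) (hbd : b + d = -(2 * p.2)) :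
    rbw (rsubdiff negLog) p ≤
      ((-√(a * b) + (1 / 2 * (p.1 - c) ^ 2 + 1 / 2 * (p.2 + d) ^ 2) : ℝ) : EReal) := by
  simp only [rbw, half_rfitz_add_half_rconj2]
  refine (iInf_le _ (p.1 - c, p.2 + d)).trans (le_of_eq ?_)
  have e1 : p.1 + (p.1 - c) = a := by linarith
  have e2 : p.2 + (p.2 + d) = -b := by linarith
  simp only [e1, e2, sub_sub_cancel, sub_add_cancel_left, neg_neg]
  rw [if_pos ⟨⟨ha, by linarith⟩, hc, hcd⟩, ← EReal.coe_add]

/-- If the multiplier of the stationary point on the hyperbola `c * d = 1` is negative, then the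
constraint is inactive and there is an unconstrained stationary point. -/
theorem exists_inactive_stationary {x s t ρ : ℝ} (ht : 0 < t) (hρ : 0 < ρ)
    (hab : 2 * x - t = ρ ^ 2 * (2 * s - t⁻¹)) (h1 : ρ⁻¹ / 2 < x - t) (h2 : ρ / 2 < s - t⁻¹) :
    ∃ α β : ℝ, 0 < α ∧ 0 < β ∧ 4 * (α * β) = 1 ∧ α * (x + α) = β * (s + β) ∧
      0 < x - α ∧ 1 ≤ (x - α) * (s - β) := by
  have hβ0 : 0 < s - t⁻¹ := by linarith [half_pos hρ]
  have hρ' : 0 < ρ⁻¹ := inv_pos.2 hρ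
  have hα0 : 0 < x - t := by linarith
  have hρρ : ρ * ρ⁻¹ = 1 := mul_inv_cancel₀ hρ.ne'
  have ht' : 0 < t⁻¹ := inv_pos.2 ht
  have htt : t * t⁻¹ = 1 := mul_inv_cancel₀ ht.ne'
  set α₀ := x - t with hα₀
  set β₀ := s - t⁻¹ with hβ₀
  have hgt : 1 < 4 * α₀ * β₀ := by nlinarith
  have hle : (4 * β₀)⁻¹ ≤ α₀ := by
    rw [inv_le_iff_one_le_mul₀ (by positivity)]; linarith
  have hρα : 1 ≤ 2 * α₀ * ρ := by nlinarith
  have hρβ : ρ ^ 2 ≤ 4 * β₀ ^ 2 := by nlinarith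
  have hx : x + α₀ = ρ ^ 2 * (s + β₀) := by rw [hα₀, hβ₀]; linarith
  have hxpos : 0 < x := by linarith
  have hspos : 0 < s := by linarith
  have hcont : ContinuousOn (fun α : ℝ => α * (x + α) - (4 * α)⁻¹ * (s + (4 * α)⁻¹))
      (Set.Icc (4 * β₀)⁻¹ α₀) := by
    have hne : ∀ α ∈ Set.Icc (4 * β₀)⁻¹ α₀, 4 * α ≠ 0 := fun α hα =>
      (mul_pos four_pos ((inv_pos.2 (by positivity : 0 < 4 * β₀)).trans_le hα.1)).ne'
    have hinv : ContinuousOn (fun α : ℝ => (4 * α)⁻¹) (Set.Icc (4 * β₀)⁻¹ α₀) :=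
      ContinuousOn.inv₀ (by fun_prop) hne
    fun_prop
  have hlo : (4 * β₀)⁻¹ * (x + (4 * β₀)⁻¹) -
      (4 * (4 * β₀)⁻¹)⁻¹ * (s + (4 * (4 * β₀)⁻¹)⁻¹) ≤ 0 := by
    have e : (4 * (4 * β₀)⁻¹)⁻¹ = β₀ := by field_simp
    rw [e]
    have e1 : (4 * β₀)⁻¹ * (4 * β₀) = 1 := inv_mul_cancel₀ (by positivity)
    have hy : 0 < (4 * β₀)⁻¹ := by positivity
    set y := (4 * β₀)⁻¹
    have hyρ : y * ρ ^ 2 ≤ β₀ := by nlinarith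
    nlinarith [mul_le_mul_of_nonneg_right hyρ (by positivity : 0 ≤ s + β₀)]
  have hhi : 0 ≤ α₀ * (x + α₀) - (4 * α₀)⁻¹ * (s + (4 * α₀)⁻¹) := by
    have e1 : (4 * α₀)⁻¹ * (4 * α₀) = 1 := inv_mul_cancel₀ (by positivity)
    have hy : 0 < (4 * α₀)⁻¹ := by positivity
    set y := (4 * α₀)⁻¹
    have hyβ : y ≤ β₀ := by nlinarith
    have hyρ : y ≤ α₀ * ρ ^ 2 := by
      have : 1 ≤ 4 * α₀ * (α₀ * ρ ^ 2) := by nlinarith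
      nlinarith
    rw [hx]
    nlinarith [mul_le_mul_of_nonneg_right hyρ (by positivity : 0 ≤ s + β₀)]
  obtain ⟨α, hα, hroot⟩ := intermediate_value_Icc hle hcont ⟨hlo, hhi⟩
  have hαpos : 0 < α := (inv_pos.2 (by positivity : 0 < 4 * β₀)).trans_le hα.1
  have hβle : (4 * α)⁻¹ ≤ β₀ := by
    rw [inv_le_iff_one_le_mul₀ (by positivity)]
    have := hα.1
    rw [inv_le_iff_one_le_mul₀ (by positivity)] at this
    linarith
  have hαle := hα.2
  refine ⟨α, (4 * α)⁻¹, hαpos, by positivity, by field_simp, sub_eq_zero.1 hroot, by linarith, ?_⟩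
  have h3 : t ≤ x - α := by linarith
  have h4 : t⁻¹ ≤ s - (4 * α)⁻¹ := by linarith
  calc (1 : ℝ) = t * t⁻¹ := htt.symm
    _ ≤ _ := mul_le_mul h3 h4 ht'.le (by linarith)

/-- The optimality system of the minimisation problem defining `ℬ`, off the boundary of its
domain. -/
theorem exists_stationary {x s : ℝ} (hx : 0 < x) (hxs : 1 < 4 * (x * s)) :
    ∃ a b c d ρ l : ℝ, 0 < a ∧ 0 < b ∧ 0 < c ∧ 0 < ρ ∧ 0 ≤ l ∧ a = ρ ^ 2 * b ∧ 1 ≤ c * d ∧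
      l * (c * d - 1) = 0 ∧ a + c = 2 * x ∧ b + d = 2 * s ∧
      2 * l * c - ρ = d - b ∧ 2 * l * d - ρ⁻¹ = c - a := by
  have hs : 0 < s := by by_contra! h; nlinarith
  have hlt : (2 * s)⁻¹ < 2 * x := by
    rw [inv_lt_iff_one_lt_mul₀ (by positivity)]; linarith
  have hlo : 0 < (2 * s)⁻¹ := by positivity
  have hcont : ContinuousOn (fun t : ℝ =>
      t * ((2 * s - t⁻¹) / 2 + (t - x) * √((2 * x - t) * (2 * s - t⁻¹)))
        - t⁻¹ * ((2 * x - t) / 2 + (t⁻¹ - s) * √((2 * x - t) * (2 * s - t⁻¹))))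
      (Set.Icc (2 * s)⁻¹ (2 * x)) := by
    have hinv : ContinuousOn (fun t : ℝ => t⁻¹) (Set.Icc (2 * s)⁻¹ (2 * x)) :=
      ContinuousOn.inv₀ continuousOn_id fun t ht => (hlo.trans_le ht.1).ne'
    fun_prop
  obtain ⟨t, ⟨ht1, ht2⟩, hroot⟩ := intermediate_value_Ioo hlt.le hcont (show (0 : ℝ) ∈ _ by
    constructor
    · simp only [inv_inv, sub_self, mul_zero, Real.sqrt_zero, zero_div, add_zero, zero_sub,
        neg_lt_zero]
      exact mul_pos (by linarith) (by linarith)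
    · simp only [sub_self, zero_mul, Real.sqrt_zero, mul_zero, zero_div, add_zero, sub_zero]
      have : (2 * x)⁻¹ < 2 * s := by
        rw [inv_lt_iff_one_lt_mul₀ (by positivity)]; linarith
      exact mul_pos (by linarith) (by linarith))
  have ht : 0 < t := hlo.trans ht1
  have htt : t * t⁻¹ = 1 := mul_inv_cancel₀ ht.ne'
  have ha : 0 < 2 * x - t := by linarith
  have hb : 0 < 2 * s - t⁻¹ := by
    rw [sub_pos, inv_lt_iff_one_lt_mul₀ ht]
    rwa [inv_lt_iff_one_lt_mul₀ (by positivity), mul_comm] at ht1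
  obtain ⟨ρ, hρ, hab⟩ : ∃ ρ : ℝ, 0 < ρ ∧ 2 * x - t = ρ ^ 2 * (2 * s - t⁻¹) :=
    ⟨√((2 * x - t) / (2 * s - t⁻¹)), by positivity, by
      rw [Real.sq_sqrt (by positivity), div_mul_cancel₀ _ hb.ne']⟩
  have hρρ : ρ * ρ⁻¹ = 1 := mul_inv_cancel₀ hρ.ne'
  have hsqrt : √((2 * x - t) * (2 * s - t⁻¹)) = ρ * (2 * s - t⁻¹) := by
    rw [hab, show ρ ^ 2 * (2 * s - t⁻¹) * (2 * s - t⁻¹) = (ρ * (2 * s - t⁻¹)) ^ 2 by ring,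
      Real.sqrt_sq (by positivity)]
  have hbal : t * (ρ⁻¹ / 2 + (t - x)) = t⁻¹ * (ρ / 2 + (t⁻¹ - s)) := by
    have h0 : (2 * s - t⁻¹) * ρ * (t * (ρ⁻¹ / 2 + (t - x)) - t⁻¹ * (ρ / 2 + (t⁻¹ - s))) = 0 := by
      simp only [hsqrt] at hroot
      linear_combination hroot + t⁻¹ / 2 * hab + (2 * s - t⁻¹) * t / 2 * hρρ
    have := (mul_eq_zero.1 h0).resolve_left (by positivity)
    linarith
  by_cases hl : 0 ≤ t * (ρ⁻¹ / 2 + (t - x))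
  · refine ⟨2 * x - t, 2 * s - t⁻¹, t, t⁻¹, ρ, t * (ρ⁻¹ / 2 + (t - x)), ha, hb, ht, hρ, hl, hab,
      htt.ge, by rw [htt]; ring, by ring, by ring, ?_, ?_⟩
    · rw [hbal]
      linear_combination (ρ + 2 * (t⁻¹ - s)) * htt
    · linear_combination (ρ⁻¹ + 2 * (t - x)) * htt
  · have h1 : ρ⁻¹ / 2 < x - t := by
      by_contra! h
      exact hl (mul_nonneg ht.le (by linarith))
    have h2 : ρ / 2 < s - t⁻¹ := by
      by_contra! h
      exact hl (hbal ▸ mul_nonneg (inv_pos.2 ht).le (by linarith))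
    obtain ⟨α, β, hα, hβ, hαβ, he, hc, hcd⟩ := exists_inactive_stationary ht hρ hab h1 h2
    have hinv : (2 * β)⁻¹ = 2 * α := inv_eq_of_mul_eq_one_right (by linarith)
    refine ⟨x + α, s + β, x - α, s - β, 2 * β, 0, by linarith, by linarith, hc, by linarith,
      le_rfl, ?_, hcd, by ring, by ring, by ring, by ring, ?_⟩
    · linear_combination 4 * β * he - (x + α) * hαβ
    · rw [hinv]
      ring

/-- Attainment of primal and dual values with no duality gap. -/
theorem exists_primal_dual {x s : ℝ} (hx : 0 < x) (hxs : 1 ≤ 4 * (x * s)) :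
    ∃ a b c d a' b' c' d' : ℝ, (0 ≤ a ∧ 0 ≤ b ∧ 0 < c ∧ 1 ≤ c * d) ∧
      (0 ≤ a' ∧ 0 ≤ b' ∧ 0 < c' ∧ 1 ≤ c' * d') ∧ a + c = 2 * x ∧ b + d = 2 * s ∧
      √(a * b) + √(a' * b') = x * ((b' + d') / 2) + (a' + c') / 2 * s
        + (1 / 2 * (x - c) ^ 2 + 1 / 2 * (s - d) ^ 2)
        + (1 / 2 * ((a' - c') / 2) ^ 2 + 1 / 2 * ((b' - d') / 2) ^ 2) := by
  have hs : 0 < s := by by_contra! h; nlinarith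
  rcases hxs.eq_or_lt with h | h
  · set k := 4 * (x ^ 2 + s ^ 2) with hk
    have hk0 : 0 < k := by positivity
    have e : k * (2 * x) * (k * (2 * s)) = k ^ 2 := by linear_combination -k ^ 2 * h
    have hkx : k * x = 4 * x ^ 3 + s := by rw [hk]; linear_combination -s * h
    refine ⟨0, 0, 2 * x, 2 * s, k * (2 * x), k * (2 * s), k * (2 * x) - 2 * s,
      k * (2 * s) - 2 * x, ⟨le_rfl, le_rfl, by positivity, by linarith⟩,
      ⟨by positivity, by positivity, ?_, ?_⟩, by ring, by ring, ?_⟩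
    · have : 0 < x ^ 3 := by positivity
      linarith
    · have : (k * (2 * x) - 2 * s) * (k * (2 * s) - 2 * x) = 1 := by
        rw [hk]; linear_combination (-(4 * (x ^ 2 + s ^ 2)) ^ 2 - 1) * h
      exact this.ge
    · rw [e, Real.sqrt_sq hk0.le, zero_mul, Real.sqrt_zero]
      linear_combination k * h
  · obtain ⟨a, b, c, d, ρ, l, ha, hb, hc, hρ, hl, hab, hcd, hlcd, hac, hbd, h1, h2⟩ :=
      exists_stationary hx h
    have hd : 0 < d := by by_contra! h'; nlinarith
    have hρ1 : ρ * ρ⁻¹ = 1 := mul_inv_cancel₀ hρ.ne'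
    have e1 : a * b = (ρ * b) ^ 2 := by rw [hab]; ring
    have e2 : 2 * l * c * (2 * l * d) = (2 * l) ^ 2 := by linear_combination 4 * l * hlcd
    refine ⟨a, b, c, d, 2 * l * c, 2 * l * d, ρ, ρ⁻¹, ⟨ha.le, hb.le, hc, hcd⟩,
      ⟨by positivity, by positivity, hρ, hρ1.ge⟩, hac, hbd, ?_⟩
    rw [e1, e2, Real.sqrt_sq (by positivity), Real.sqrt_sq (by positivity)]
    obtain rfl : x = (a + c) / 2 := by linarith
    obtain rfl : s = (b + d) / 2 := by linarith
    have q1 : ((2 * l * c - ρ) / 2) ^ 2 = ((b - d) / 2) ^ 2 := by rw [h1]; ring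
    have q2 : ((2 * l * d - ρ⁻¹) / 2) ^ 2 = ((a - c) / 2) ^ 2 := by rw [h2]; ring
    linear_combination -1 / 2 * q1 - 1 / 2 * q2 - (a - c) / 4 * h2 - (b - d) / 4 * h1
      - ρ⁻¹ / 2 * hab - ρ * b / 2 * hρ1 - 2 * hlcd

theorem sqrt_add_sqrt_le {a b c d a' b' c' d' : ℝ} (ha : 0 ≤ a) (hb : 0 ≤ b) (hc : 0 < c)
    (hcd : 1 ≤ c * d) (ha' : 0 ≤ a') (hb' : 0 ≤ b') (hc' : 0 < c') (hcd' : 1 ≤ c' * d') :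
    √(a * b) + √(a' * b') ≤ (a + c) / 2 * ((b' + d') / 2) + (a' + c') / 2 * ((b + d) / 2)
        + (1 / 2 * ((a - c) / 2) ^ 2 + 1 / 2 * ((b - d) / 2) ^ 2)
        + (1 / 2 * ((a' - c') / 2) ^ 2 + 1 / 2 * ((b' - d') / 2) ^ 2) := by
  have h1 := two_mul_sqrt_le ha hb hc' hcd'
  have h2 := two_mul_sqrt_le ha' hb' hc hcd
  nlinarith [sq_nonneg ((a - c) + (b' - d')), sq_nonneg ((b - d) + (a' - c'))]

theorem rbw_negLog_eq_top {p : ℝ × ℝ} (h : ¬(0 < p.1 ∧ 1 ≤ 4 * (p.1 * -p.2))) :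
    rbw (rsubdiff negLog) p = ⊤ := by
  refine top_le_iff.1 (le_rbw_negLog fun a b c d ha hb hc hcd hac hbd => ?_)
  have hd : 0 < d := by by_contra! h'; nlinarith
  refine absurd ⟨by linarith, ?_⟩ h
  have e1 : p.1 = (a + c) / 2 := by linarith
  have e2 : -p.2 = (b + d) / 2 := by linarith
  rw [e1, e2]
  nlinarith [mul_nonneg ha hb, mul_nonneg ha hd.le, mul_nonneg hb hc.le]

theorem rconj2_rbw_negLog_le (x x' : ℝ) :
    rconj2 (rbw (rsubdiff negLog)) (x', x) ≤ rbw (rsubdiff negLog) (x, x') := by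
  refine le_rbw_negLog fun a b c d ha hb hc hcd hac hbd => ?_
  refine rconj2_le_coe fun q => ?_
  refine le_rbw_negLog fun a' b' c' d' ha' hb' hc' hcd' hac' hbd' => ?_
  rw [EReal.coe_le_coe_iff]
  have := sqrt_add_sqrt_le ha hb hc hcd ha' hb' hc' hcd'
  obtain ⟨y, y'⟩ := q
  simp only at *
  obtain rfl : x = (a + c) / 2 := by linarith
  obtain rfl : x' = -((b + d) / 2) := by linarith
  obtain rfl : y = (a' + c') / 2 := by linarith
  obtain rfl : y' = -((b' + d') / 2) := by linarith
  linarith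

/-- On its domain, `ℬ` attains its infimum and is minorised by its conjugate. -/
theorem exists_rbw_negLog_eq {x x' : ℝ} (hx : 0 < x) (hxs : 1 ≤ 4 * (x * -x')) :
    ∃ a b c d : ℝ, (0 ≤ a ∧ 0 ≤ b ∧ 0 < c ∧ 1 ≤ c * d) ∧ a + c = 2 * x ∧
      b + d = 2 * -x' ∧
      rbw (rsubdiff negLog) (x, x') =
        ((-√(a * b) + (1 / 2 * (x - c) ^ 2 + 1 / 2 * (x' + d) ^ 2) : ℝ) : EReal) ∧
      rbw (rsubdiff negLog) (x, x') ≤ rconj2 (rbw (rsubdiff negLog)) (x', x) := by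
  obtain ⟨a, b, c, d, a', b', c', d', ⟨ha, hb, hc, hcd⟩, ⟨ha', hb', hc', hcd'⟩, hac, hbd, h⟩ :=
    exists_primal_dual hx hxs
  have hle := rbw_negLog_le (p := (x, x')) ha hb hc hcd hac (by simp only; linarith)
  have hle' := rbw_negLog_le (p := ((a' + c') / 2, -((b' + d') / 2))) ha' hb' hc' hcd'
    (by simp only; ring) (by simp only; ring)
  have hge : ((-√(a * b) + (1 / 2 * (x - c) ^ 2 + 1 / 2 * (x' + d) ^ 2) : ℝ) : EReal) ≤
      rconj2 (rbw (rsubdiff negLog)) (x', x) := by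
    refine coe_le_rconj2 ((a' + c') / 2, -((b' + d') / 2)) (hle'.trans (le_of_eq ?_))
    rw [EReal.coe_eq_coe_iff]
    simp only
    linear_combination -h
  exact ⟨a, b, c, d, ⟨ha, hb, hc, hcd⟩, hac, hbd,
    le_antisymm hle (hge.trans (rconj2_rbw_negLog_le x x')), hle.trans hge⟩

theorem rAutoconjugate_rbw_negLog : rAutoconjugate (rbw (rsubdiff negLog)) := by
  intro x x'
  by_cases h : 0 < x ∧ 1 ≤ 4 * (x * -x')
  · obtain ⟨-, -, -, -, -, -, -, -, hle⟩ := exists_rbw_negLog_eq h.1 h.2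
    exact le_antisymm (rconj2_rbw_negLog_le x x') hle
  · rw [rbw_negLog_eq_top (p := (x, x')) h]
    obtain ⟨m, n, hm, hn, hmn, hlt⟩ := exists_mul_eq_one_add_lt_two (x := 2 * x) (s := 2 * -x')
      (fun h' => h ⟨by linarith [h'.1], by linarith [h'.2]⟩)
    refine eq_top_of_forall_coe_le fun r => ?_
    set δ := 1 - (m * -x' + n * x) with hδ
    have hδ0 : 0 < δ := by linarith
    have hκ : 1 ≤ 1 + |r| / δ := le_add_of_nonneg_right (by positivity)
    have hκδ : (1 + |r| / δ) * δ = δ + |r| := by field_simp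
    set κ := 1 + |r| / δ
    have hκ0 : 0 < κ := by linarith
    have e : κ * m * (κ * n) = κ ^ 2 := by linear_combination κ ^ 2 * hmn
    have hle := rbw_negLog_le (p := (κ * m, -(κ * n))) (a := κ * m) (b := κ * n)
      (c := κ * m) (d := κ * n) (by positivity) (by positivity) (by positivity)
      (by rw [e]; nlinarith) (by simp only; ring) (by simp only; ring)
    refine coe_le_rconj2 _ (hle.trans ?_)
    rw [e, Real.sqrt_sq hκ0.le, EReal.coe_le_coe_iff]
    simp only
    nlinarith [le_abs_self r]

theorem rIsRepresenter_rbw_negLog :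
    rIsRepresenter (rbw (rsubdiff negLog)) (rsubdiff negLog) := by
  intro x x'
  rw [mem_rsubdiff_negLog]
  have key : ∀ a b c d : ℝ, 0 ≤ a → 0 ≤ b → 1 ≤ c * d → a + c = 2 * x → b + d = 2 * -x' →
      1 / 2 * (√(a * b) - 1) ^ 2 + 1 / 2 * (c * d - 1) + 1 / 2 * (x - c + (x' + d)) ^ 2 =
      -√(a * b) + (1 / 2 * (x - c) ^ 2 + 1 / 2 * (x' + d) ^ 2) - x * x' := by
    intro a b c d ha hb hcd hac hbd
    have := Real.sq_sqrt (mul_nonneg ha hb)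
    obtain rfl : a = 2 * x - c := by linarith
    obtain rfl : b = 2 * -x' - d := by linarith
    linear_combination 1 / 2 * this
  constructor
  · rintro ⟨hx, h⟩
    have hle := rbw_negLog_le (p := (x, x')) (a := x) (b := -x') (c := x) (d := -x') hx.le
      (by by_contra! h'; nlinarith) hx (by linarith) (by simp only; ring) (by simp only; ring)
    apply le_antisymm
    · refine hle.trans (le_of_eq ?_)
      rw [EReal.coe_eq_coe_iff, show x * -x' = 1 by linarith, Real.sqrt_one]
      simp only
      linear_combination -h
    · refine le_rbw_negLog fun a b c d ha hb hc hcd hac hbd => ?_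
      rw [EReal.coe_le_coe_iff]
      have := key a b c d ha hb hcd hac (hbd.trans (by simp only; ring))
      simp only
      nlinarith [sq_nonneg (√(a * b) - 1), sq_nonneg (x - c + (x' + d))]
  · intro h
    by_cases hd : 0 < x ∧ 1 ≤ 4 * (x * -x')
    · obtain ⟨a, b, c, d, ⟨ha, hb, hc, hcd⟩, hac, hbd, heq, -⟩ := exists_rbw_negLog_eq hd.1 hd.2
      rw [heq, EReal.coe_eq_coe_iff] at h
      have hk := key a b c d ha hb hcd hac hbd
      have hab : √(a * b) = 1 := by
        nlinarith [sq_nonneg (√(a * b) - 1), sq_nonneg (x - c + (x' + d))]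
      have hcd1 : c * d = 1 := by
        nlinarith [sq_nonneg (√(a * b) - 1), sq_nonneg (x - c + (x' + d))]
      have hsum : x - c + (x' + d) = 0 := by
        nlinarith [sq_nonneg (√(a * b) - 1), sq_nonneg (x - c + (x' + d))]
      refine ⟨hd.1, ?_⟩
      have hab1 : a * b = 1 := by
        have := Real.sq_sqrt (mul_nonneg ha hb)
        rw [hab] at this
        linarith
      obtain rfl : a = 2 * x - c := by linarith
      obtain rfl : b = 2 * -x' - d := by linarith
      have hs : 0 < -x' := by by_contra! h'; nlinarith
      have hα : (x - c) * (x - x') = 0 := by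
        linear_combination 1 / 2 * hab1 - 1 / 2 * hcd1 + x * hsum
      have hxc := (mul_eq_zero.1 hα).resolve_right (by linarith)
      obtain rfl : c = x := by linarith
      obtain rfl : d = -x' := by linarith
      linarith
    · rw [rbw_negLog_eq_top (p := (x, x')) hd] at h
      exact absurd h.symm (EReal.coe_ne_top _)

theorem pos_and_one_le_iff {k x x' : ℝ} (hk : 0 < k) :
    0 < x ∧ 1 ≤ k * x * -x' ↔ x' ≤ -(1 / (k * x)) ∧ -(1 / (k * x)) < 0 := by
  rw [neg_lt_zero, one_div_pos, mul_pos_iff_of_pos_left hk, and_comm]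
  refine and_congr_left fun hx => ?_
  rw [le_neg, div_le_iff₀' (mul_pos hk hx)]

/-- Theorem 5.1. For the negative logarithm `f`, the representers
`𝒜_{∂f}`, `ℬ_{∂f}` and `f ⊕ f*` have domains `{(x,x*) : x* ≤ -1/(2x) < 0}`,
`{(x,x*) : x* ≤ -1/(4x) < 0}` and `(0,∞) × (-∞,0)` respectively; consequently they are
three pairwise distinct autoconjugate representers for `∂f`. -/
theorem stmt13 :
    {p : ℝ × ℝ | rpz (rsubdiff negLog) p ≠ ⊤}
        = {p : ℝ × ℝ | p.2 ≤ -(1 / (2 * p.1)) ∧ -(1 / (2 * p.1)) < 0} ∧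
    {p : ℝ × ℝ | rbw (rsubdiff negLog) p ≠ ⊤}
        = {p : ℝ × ℝ | p.2 ≤ -(1 / (4 * p.1)) ∧ -(1 / (4 * p.1)) < 0} ∧
    {p : ℝ × ℝ | negLog p.1 + rconj negLog p.2 ≠ ⊤}
        = {p : ℝ × ℝ | 0 < p.1 ∧ p.2 < 0} ∧
    rpz (rsubdiff negLog) ≠ rbw (rsubdiff negLog) ∧
    rpz (rsubdiff negLog) ≠ (fun p : ℝ × ℝ => negLog p.1 + rconj negLog p.2) ∧
    rbw (rsubdiff negLog) ≠ (fun p : ℝ × ℝ => negLog p.1 + rconj negLog p.2) ∧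
    rAutoconjugate (rpz (rsubdiff negLog)) ∧
    rAutoconjugate (rbw (rsubdiff negLog)) ∧
    rAutoconjugate (fun p : ℝ × ℝ => negLog p.1 + rconj negLog p.2) ∧
    rIsRepresenter (rpz (rsubdiff negLog)) (rsubdiff negLog) ∧
    rIsRepresenter (rbw (rsubdiff negLog)) (rsubdiff negLog) ∧
    rIsRepresenter (fun p : ℝ × ℝ => negLog p.1 + rconj negLog p.2) (rsubdiff negLog) := by
  have hA : {p : ℝ × ℝ | rpz (rsubdiff negLog) p ≠ ⊤}
      = {p : ℝ × ℝ | p.2 ≤ -(1 / (2 * p.1)) ∧ -(1 / (2 * p.1)) < 0} := by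
    ext p
    rw [Set.mem_ofPred_eq, Set.mem_ofPred_eq, rpz_negLog, ite_ne_right_iff,
      and_iff_left (EReal.coe_ne_top _), ← mul_assoc]
    exact pos_and_one_le_iff two_pos
  have hB : {p : ℝ × ℝ | rbw (rsubdiff negLog) p ≠ ⊤}
      = {p : ℝ × ℝ | p.2 ≤ -(1 / (4 * p.1)) ∧ -(1 / (4 * p.1)) < 0} := by
    ext p
    rw [Set.mem_ofPred_eq, Set.mem_ofPred_eq, ← pos_and_one_le_iff four_pos, mul_assoc]
    refine ⟨fun h => ?_, fun h => ?_⟩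
    · by_contra h'
      exact h (rbw_negLog_eq_top h')
    · obtain ⟨_, _, _, _, -, -, -, heq, -⟩ := exists_rbw_negLog_eq h.1 h.2
      rw [heq]
      exact EReal.coe_ne_top _
  have hC : {p : ℝ × ℝ | negLog p.1 + rconj negLog p.2 ≠ ⊤}
      = {p : ℝ × ℝ | 0 < p.1 ∧ p.2 < 0} := by
    ext p
    rw [Set.mem_ofPred_eq, Set.mem_ofPred_eq, negLog_add_rconj_negLog, ite_ne_right_iff,
      and_iff_left (EReal.coe_ne_top _)]
  refine ⟨hA, hB, hC, fun h => ?_, fun h => ?_, fun h => ?_, rAutoconjugate_rpz_negLog,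
    rAutoconjugate_rbw_negLog, rAutoconjugate_negLog_add_rconj, rIsRepresenter_rpz_negLog,
    rIsRepresenter_rbw_negLog, rIsRepresenter_negLog_add_rconj⟩
  · rw [h, hB] at hA
    have := (Set.ext_iff.1 hA (1, -1 / 4)).1 (by norm_num)
    norm_num at this
  · rw [h, hC] at hA
    have := (Set.ext_iff.1 hA (1, -1 / 8)).1 (by norm_num)
    norm_num at this
  · rw [h, hC] at hB
    have := (Set.ext_iff.1 hB (1, -1 / 8)).1 (by norm_num)
    norm_num at this
end
end

section
/- Let B: X* → X be continuous, linear, symmetric, monotone, and one-to-one, and let A = B⁻¹ (a maximal monotone, at most single-valued operator with dom A = ran B). Then: (i) 𝒜_A = q_A ⊕ q_B = (q_B* + ι_{dom A}) ⊕ q_B, i.e. 𝒜_A(x,x*) = q_A(x) + q_B(x*) for all (x,x*) ∈ X×X*; (ii) ℬ_A = 𝒜_A** = q_B* ⊕ q_B, i.e. ℬ_A(x,x*) = q_B*(x) + q_B(x*); (iii) both 𝒜_A and ℬ_A are representers for A; and (iv) 𝒜_A = ℬ_A if and only if dom q_B* = dom A. -/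
noncomputable section
open scoped Classical
open Filter Topology

/-- The conjugate of a function on `X* × X`, as a function on `X × X*`:
`G*(x,x*) = sup_{(y*,y)} (⟨x,y*⟩ + ⟨y,x*⟩ - G(y*,y))`. -/
def conj2' {X : Type*} [NormedAddCommGroup X] [NormedSpace ℝ X]
    (G : (X →L[ℝ] ℝ) × X → EReal) : X × (X →L[ℝ] ℝ) → EReal :=
  fun p => ⨆ q : (X →L[ℝ] ℝ) × X, ((q.1 p.1 + p.2 q.2 : ℝ) : EReal) - G q

section Stmt18

variable {X : Type*} [NormedAddCommGroup X] [NormedSpace ℝ X]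
variable (B : (X →L[ℝ] ℝ) →L[ℝ] X)

/-- The inverse `A = B⁻¹ : X ⇉ X*` of `B : X* → X`, with graph `{(Bu, u)}`. -/
def invOp : X → Set (X →L[ℝ] ℝ) := fun x => {u | B u = x}

/-- `q_B(x*) = ½⟨Bx*,x*⟩`. -/
def qB : (X →L[ℝ] ℝ) → ℝ := fun u => 1 / 2 * u (B u)

/-- `q_B* : X → (-∞,+∞]`, `q_B*(x) = sup_{y*} (⟨x,y*⟩ - q_B(y*))`. -/
def qBstar : X → EReal := fun x => ⨆ u : X →L[ℝ] ℝ, ((u x - qB B u : ℝ) : EReal)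

/-- `q_A(x) = ½⟨x,Ax⟩` for `x ∈ dom A = ran B`, `+∞` otherwise, where `A = B⁻¹`. -/
def qAinv : X → EReal :=
  fun x => if h : ∃ u : X →L[ℝ] ℝ, B u = x then ((1 / 2 * h.choose x : ℝ) : EReal) else ⊤

/-- The Fitzpatrick function of `A = B⁻¹`:
`F_A(x,x*) = sup_{u} (⟨x,u⟩ + ⟨Bu,x*⟩ - ⟨Bu,u⟩)`. -/
def fitzInv : X × (X →L[ℝ] ℝ) → EReal :=
  fun p => ⨆ u : X →L[ℝ] ℝ, ((u p.1 + p.2 (B u) - u (B u) : ℝ) : EReal)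

/-- The Penot–Zălinescu function of `A = B⁻¹`. -/
def pzInv : X × (X →L[ℝ] ℝ) → EReal :=
  fun p => ⨅ y' : X →L[ℝ] ℝ,
    ((1 / 2 : ℝ) : EReal) * fitzInv B (p.1, p.2 + y')
      + ((1 / 2 : ℝ) : EReal) * conj2 (fitzInv B) (p.2 - y', p.1)

/-- The proximal-average based function of `A = B⁻¹`. -/
def bwInv : X × (X →L[ℝ] ℝ) → EReal :=
  fun p => ⨅ q : X × (X →L[ℝ] ℝ),
    ((1 / 2 : ℝ) : EReal) * fitzInv B (p.1 + q.1, p.2 + q.2)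
      + ((1 / 2 : ℝ) : EReal) * conj2 (fitzInv B) (p.2 - q.2, p.1 - q.1)
      + ((1 / 2 * ‖q.1‖ ^ 2 + 1 / 2 * ‖q.2‖ ^ 2 : ℝ) : EReal)

end Stmt18

theorem EReal.iSup_coe_mul_add {ι : Type*} [Nonempty ι] (a : ι → ℝ) {c : ℝ} (hc : 0 < c)
    (d : ℝ) :
    (⨆ i, ((c * a i + d : ℝ) : EReal)) = (c : EReal) * (⨆ i, (a i : EReal)) + (d : EReal) := by
  have h0 := Classical.arbitrary ι
  have hS : ∀ i, (a i : EReal) ≤ ⨆ i, (a i : EReal) := fun i => le_iSup (fun i => (a i : EReal)) i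
  have hT : ∀ i, ((c * a i + d : ℝ) : EReal) ≤ ⨆ i, ((c * a i + d : ℝ) : EReal) :=
    fun i => le_iSup (fun i => ((c * a i + d : ℝ) : EReal)) i
  apply le_antisymm
  · refine iSup_le fun i => ?_
    rw [EReal.coe_add, EReal.coe_mul]
    exact add_le_add (mul_le_mul_of_nonneg_left (hS i) (by exact_mod_cast hc.le)) le_rfl
  · generalize (⨆ i, ((c * a i + d : ℝ) : EReal)) = T at hT
    induction T with
    | bot => exact absurd (le_bot_iff.1 (hT h0)) (EReal.coe_ne_bot _)
    | top => exact le_top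
    | coe t =>
      have h : (⨆ i, (a i : EReal)) ≤ (((t - d) / c : ℝ) : EReal) := by
        refine iSup_le fun i => ?_
        have := hT i
        norm_cast at this ⊢
        rw [le_div_iff₀ hc]
        linarith
      calc (c : EReal) * (⨆ i, (a i : EReal)) + (d : EReal)
          ≤ (c : EReal) * (((t - d) / c : ℝ) : EReal) + (d : EReal) :=
            add_le_add (mul_le_mul_of_nonneg_left h (by exact_mod_cast hc.le)) le_rfl
        _ = ((c * ((t - d) / c) + d : ℝ) : EReal) := by norm_cast
        _ = t := by congr 1; field_simp; ring

section InverseOperator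

variable {X : Type*} [NormedAddCommGroup X] [NormedSpace ℝ X] {B : (X →L[ℝ] ℝ) →L[ℝ] X}

theorem le_qBstar (x : X) (u : X →L[ℝ] ℝ) : ((u x - qB B u : ℝ) : EReal) ≤ qBstar B x :=
  le_iSup (fun u : X →L[ℝ] ℝ => ((u x - qB B u : ℝ) : EReal)) u

theorem qBstar_nonneg (x : X) : 0 ≤ qBstar B x := by
  simpa [qB] using le_qBstar (B := B) x 0

theorem qBstar_ne_bot (x : X) : qBstar B x ≠ ⊥ :=
  (lt_of_lt_of_le EReal.bot_lt_zero (qBstar_nonneg x)).ne'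

theorem qBstar_add_coe (x : X) (d : ℝ) :
    qBstar B x + (d : EReal) = ⨆ u : X →L[ℝ] ℝ, ((u x - qB B u + d : ℝ) : EReal) := by
  have := EReal.iSup_coe_mul_add (fun u : X →L[ℝ] ℝ => u x - qB B u) one_pos d
  simp only [one_mul, EReal.coe_one] at this
  exact this.symm

theorem qBstar_apply (hsym : ∀ u v : X →L[ℝ] ℝ, v (B u) = u (B v))
    (hmono : ∀ u : X →L[ℝ] ℝ, 0 ≤ u (B u)) (w : X →L[ℝ] ℝ) :
    qBstar B (B w) = ((qB B w : ℝ) : EReal) := by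
  apply le_antisymm
  · refine iSup_le fun u => ?_
    have h := hmono (u - w)
    have h' := hsym u w
    simp only [map_sub, sub_apply] at h
    norm_cast
    simp only [qB]
    linarith
  · refine le_trans ?_ (le_qBstar (B w) w)
    norm_cast
    simp only [qB]
    linarith

theorem qBstar_add_map (hsym : ∀ u v : X →L[ℝ] ℝ, v (B u) = u (B v)) (x : X)
    (v : X →L[ℝ] ℝ) :
    qBstar B (x + B v) = qBstar B x + ((v x + qB B v : ℝ) : EReal) := by
  rw [qBstar_add_coe, qBstar, ← (Equiv.addRight v).iSup_comp]
  refine iSup_congr fun u => ?_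
  have h := hsym u v
  congr 1
  simp only [Equiv.coe_addRight, qB, map_add, add_apply]
  linarith

theorem eq_apply_of_qBstar_add_eq (hsym : ∀ u v : X →L[ℝ] ℝ, v (B u) = u (B v)) {x : X}
    {x' : X →L[ℝ] ℝ} (h : qBstar B x + ((qB B x' : ℝ) : EReal) = ((x' x : ℝ) : EReal)) :
    B x' = x := by
  refine (SeparatingDual.eq_iff_forall_dual_eq (R := ℝ)).2 fun g => ?_
  have key : ∀ t : ℝ, 0 ≤ t * g (B x' - x) + t ^ 2 * qB B g := by
    intro t
    have h1 := add_le_add (le_qBstar (B := B) x (x' + t • g)) (le_refl ((qB B x' : ℝ) : EReal))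
    rw [h] at h1
    norm_cast at h1
    have h2 := hsym g x'
    simp only [qB, map_add, map_smul, map_sub, add_apply,
      smul_apply, smul_eq_mul] at h1 ⊢
    rw [h2] at h1
    linarith
  set a := g (B x' - x) with ha
  set b := qB B g
  have : a = 0 := by
    by_contra hne
    have hb : 0 < |b| + 1 := by positivity
    have h1 := key (-a / (|b| + 1))
    have h2 : -a / (|b| + 1) * a + (-a / (|b| + 1)) ^ 2 * b
        = a ^ 2 / (|b| + 1) ^ 2 * (b - (|b| + 1)) := by
      field_simp
      ring
    rw [h2] at h1
    have h3 : 0 < a ^ 2 / (|b| + 1) ^ 2 := by positivity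
    nlinarith [le_abs_self b]
  rw [ha, map_sub] at this
  linarith

theorem qBstar_add_eq_iff (hsym : ∀ u v : X →L[ℝ] ℝ, v (B u) = u (B v))
    (hmono : ∀ u : X →L[ℝ] ℝ, 0 ≤ u (B u)) {x : X} {x' : X →L[ℝ] ℝ} :
    qBstar B x + ((qB B x' : ℝ) : EReal) = ((x' x : ℝ) : EReal) ↔ B x' = x := by
  refine ⟨eq_apply_of_qBstar_add_eq hsym, ?_⟩
  rintro rfl
  rw [qBstar_apply hsym hmono]
  norm_cast
  simp only [qB]
  ring

theorem half_mul_fitzInv (hsym : ∀ u v : X →L[ℝ] ℝ, v (B u) = u (B v)) {y z : X}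
    {y' : X →L[ℝ] ℝ} (hz : y + B y' = (2 : ℝ) • z) :
    ((1 / 2 : ℝ) : EReal) * fitzInv B (y, y') = qBstar B z := by
  have h := EReal.iSup_coe_mul_add (fun u : X →L[ℝ] ℝ => u y + y' (B u) - u (B u))
    (by norm_num : (0 : ℝ) < 1 / 2) 0
  simp only [EReal.coe_zero, add_zero] at h
  rw [fitzInv, ← h, qBstar]
  refine iSup_congr fun u => ?_
  have h1 := congrArg u hz
  rw [map_add, map_smul, smul_eq_mul, hsym] at h1
  congr 1
  simp only [qB]
  linarith

theorem half_mul_fitzInv_nonneg (y : X) (y' : X →L[ℝ] ℝ) :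
    0 ≤ ((1 / 2 : ℝ) : EReal) * fitzInv B (y, y') := by
  refine mul_nonneg (by exact_mod_cast (by norm_num : (0 : ℝ) ≤ 1 / 2)) ?_
  refine le_trans (le_of_eq ?_)
    (le_iSup (fun u : X →L[ℝ] ℝ => ((u y + y' (B u) - u (B u) : ℝ) : EReal)) 0)
  simp

theorem conj2_fitzInv_apply (hsym : ∀ u v : X →L[ℝ] ℝ, v (B u) = u (B v))
    (hmono : ∀ u : X →L[ℝ] ℝ, 0 ≤ u (B u)) (u : X →L[ℝ] ℝ) :
    conj2 (fitzInv B) (u, B u) = ((u (B u) : ℝ) : EReal) := by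
  apply le_antisymm
  · refine iSup_le fun q => EReal.sub_le_of_le_add' ?_
    calc ((u q.1 + q.2 (B u) : ℝ) : EReal)
        = ((u q.1 + q.2 (B u) - u (B u) : ℝ) : EReal) + ((u (B u) : ℝ) : EReal) := by
          rw [← EReal.coe_add, sub_add_cancel]
      _ ≤ fitzInv B q + ((u (B u) : ℝ) : EReal) := add_le_add
          (le_iSup (fun u : X →L[ℝ] ℝ => ((u q.1 + q.2 (B u) - u (B u) : ℝ) : EReal)) u) le_rfl
  · have hF : fitzInv B (B u, u) ≤ ((u (B u) : ℝ) : EReal) := by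
      refine iSup_le fun w => ?_
      have h := hmono (w - u)
      have h' := hsym u w
      simp only [map_sub, sub_apply] at h
      norm_cast
      linarith
    refine le_trans ?_ (le_iSup (fun q : X × (X →L[ℝ] ℝ) =>
      ((u q.1 + q.2 (B u) : ℝ) : EReal) - fitzInv B q) (B u, u))
    refine le_trans ?_ (EReal.sub_le_sub le_rfl hF)
    norm_cast
    linarith

theorem conj2_fitzInv_eq_top (hsym : ∀ u v : X →L[ℝ] ℝ, v (B u) = u (B v))
    (hmono : ∀ u : X →L[ℝ] ℝ, 0 ≤ u (B u)) {u : X →L[ℝ] ℝ} {x : X} (hx : B u ≠ x) :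
    conj2 (fitzInv B) (u, x) = ⊤ := by
  obtain ⟨g, hg⟩ := SeparatingDual.exists_eq_one (R := ℝ) (sub_ne_zero.2 hx.symm)
  rw [eq_top_iff]
  refine EReal.ge_of_forall_gt_iff_ge.1 fun t _ => ?_
  have hF : fitzInv B (-B (t • g), t • g) ≤ 0 := by
    refine iSup_le fun w => ?_
    have h := hmono w
    have h' := hsym (t • g) w
    rw [map_neg]
    norm_cast
    linarith
  refine le_trans ?_ (le_iSup (fun q : X × (X →L[ℝ] ℝ) =>
    ((u q.1 + q.2 x : ℝ) : EReal) - fitzInv B q) (-B (t • g), t • g))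
  refine le_trans ?_ (EReal.sub_le_sub le_rfl hF)
  have h' := hsym g u
  rw [map_sub] at hg
  simp only [map_neg, map_smul, smul_apply, smul_eq_mul, sub_zero, h']
  norm_cast
  exact le_of_eq (by linear_combination (-t) * hg)

theorem qAinv_apply (hinj : Function.Injective B) (u : X →L[ℝ] ℝ) :
    qAinv B (B u) = ((qB B u : ℝ) : EReal) := by
  have h : ∃ v : X →L[ℝ] ℝ, B v = B u := ⟨u, rfl⟩
  rw [qAinv, dif_pos h, hinj h.choose_spec, qB]

theorem pzInv_eq (hsym : ∀ u v : X →L[ℝ] ℝ, v (B u) = u (B v))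
    (hmono : ∀ u : X →L[ℝ] ℝ, 0 ≤ u (B u)) (hinj : Function.Injective B) (x : X)
    (x' : X →L[ℝ] ℝ) :
    pzInv B (x, x') = qAinv B x + ((qB B x' : ℝ) : EReal) := by
  have htop : ∀ y' : X →L[ℝ] ℝ, B (x' - y') ≠ x →
      ((1 / 2 : ℝ) : EReal) * fitzInv B (x, x' + y')
        + ((1 / 2 : ℝ) : EReal) * conj2 (fitzInv B) (x' - y', x) = ⊤ := by
    intro y' h
    rw [conj2_fitzInv_eq_top hsym hmono h, EReal.coe_mul_top_of_pos (by norm_num)]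
    exact EReal.add_top_of_ne_bot
      (lt_of_lt_of_le EReal.bot_lt_zero (half_mul_fitzInv_nonneg _ _)).ne'
  by_cases hx : ∃ u : X →L[ℝ] ℝ, B u = x
  · obtain ⟨u, rfl⟩ := hx
    have hval : ((1 / 2 : ℝ) : EReal) * fitzInv B (B u, x' + (x' - u))
        + ((1 / 2 : ℝ) : EReal) * conj2 (fitzInv B) (x' - (x' - u), B u)
        = qAinv B (B u) + ((qB B x' : ℝ) : EReal) := by
      rw [sub_sub_cancel, conj2_fitzInv_apply hsym hmono,
        half_mul_fitzInv hsym (z := B x') (by simp only [map_add, map_sub, two_smul]; abel),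
        qBstar_apply hsym hmono, qAinv_apply hinj, add_comm, qB, qB]
      norm_cast
    apply le_antisymm
    · exact hval ▸ iInf_le (fun y' : X →L[ℝ] ℝ =>
        ((1 / 2 : ℝ) : EReal) * fitzInv B (B u, x' + y')
          + ((1 / 2 : ℝ) : EReal) * conj2 (fitzInv B) (x' - y', B u)) (x' - u)
    · refine le_iInf fun y' => ?_
      by_cases h : B (x' - y') = B u
      · obtain rfl : y' = x' - u := by rw [← hinj h, sub_sub_cancel]
        exact hval.ge
      · exact le_of_le_of_eq le_top (htop y' h).symm
  · rw [qAinv, dif_neg hx, EReal.top_add_coe, pzInv, iInf_eq_top]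
    exact fun y' => htop y' fun h => hx ⟨_, h⟩

theorem qAinv_eq (hsym : ∀ u v : X →L[ℝ] ℝ, v (B u) = u (B v))
    (hmono : ∀ u : X →L[ℝ] ℝ, 0 ≤ u (B u)) (hinj : Function.Injective B) (x : X) :
    qAinv B x = qBstar B x + (if ∃ u : X →L[ℝ] ℝ, B u = x then (0 : EReal) else ⊤) := by
  split_ifs with hx
  · obtain ⟨u, rfl⟩ := hx
    rw [qAinv_apply hinj, qBstar_apply hsym hmono, add_zero]
  · rw [qAinv, dif_neg hx, EReal.add_top_of_ne_bot (qBstar_ne_bot x)]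

theorem conj2_pzInv (hsym : ∀ u v : X →L[ℝ] ℝ, v (B u) = u (B v))
    (hmono : ∀ u : X →L[ℝ] ℝ, 0 ≤ u (B u)) (hinj : Function.Injective B) (x : X)
    (x' : X →L[ℝ] ℝ) :
    conj2 (pzInv B) (x', x) = qBstar B x + ((qB B x' : ℝ) : EReal) := by
  apply le_antisymm
  · refine iSup_le ?_
    rintro ⟨y, y'⟩
    rw [pzInv_eq hsym hmono hinj]
    by_cases hy : ∃ u : X →L[ℝ] ℝ, B u = y
    · obtain ⟨u, rfl⟩ := hy
      rw [qAinv_apply hinj]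
      refine le_trans ?_ (add_le_add (le_qBstar x y') le_rfl)
      have h := hmono (u - x')
      have h' := hsym u x'
      simp only [map_sub, sub_apply] at h
      norm_cast
      simp only [qB]
      linarith
    · rw [qAinv, dif_neg hy, EReal.top_add_coe, EReal.sub_top]
      exact bot_le
  · rw [qBstar_add_coe]
    refine iSup_le fun u => ?_
    refine le_trans (le_of_eq ?_) (le_iSup (fun q : X × (X →L[ℝ] ℝ) =>
      ((x' q.1 + q.2 x : ℝ) : EReal) - pzInv B q) (B x', u))
    rw [pzInv_eq hsym hmono hinj, qAinv_apply hinj]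
    norm_cast
    simp only [qB]
    ring

theorem conj2'_conj2_pzInv (hsym : ∀ u v : X →L[ℝ] ℝ, v (B u) = u (B v))
    (hmono : ∀ u : X →L[ℝ] ℝ, 0 ≤ u (B u)) (hinj : Function.Injective B) (x : X)
    (x' : X →L[ℝ] ℝ) :
    conj2' (conj2 (pzInv B)) (x, x') = qBstar B x + ((qB B x' : ℝ) : EReal) := by
  apply le_antisymm
  · refine iSup_le ?_
    rintro ⟨y', y⟩
    rw [conj2_pzInv hsym hmono hinj]
    refine le_trans (EReal.sub_le_sub le_rfl (add_le_add (le_qBstar y x') le_rfl))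
      (le_trans (le_of_eq ?_) (add_le_add (le_qBstar x y') le_rfl))
    norm_cast
    ring
  · rw [qBstar_add_coe]
    refine iSup_le fun u => ?_
    refine le_trans (le_of_eq ?_) (le_iSup (fun q : (X →L[ℝ] ℝ) × X =>
      ((q.1 x + x' q.2 : ℝ) : EReal) - conj2 (pzInv B) q) (u, B x'))
    rw [conj2_pzInv hsym hmono hinj, qBstar_apply hsym hmono]
    norm_cast
    simp only [qB]
    ring

/-- Approximate solvability of `a ∈ B v + J v`, where `J` is the duality map of `X*`. -/
theorem exists_fenchel_gap_le (hsym : ∀ u v : X →L[ℝ] ℝ, v (B u) = u (B v))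
    (hmono : ∀ u : X →L[ℝ] ℝ, 0 ≤ u (B u)) (a : X) {ε : ℝ} (hε : 0 < ε) :
    ∃ v : X →L[ℝ] ℝ,
      1 / 2 * ‖a - B v‖ ^ 2 + 1 / 2 * ‖v‖ ^ 2 - v (a - B v) ≤ ε := by
  set g : (X →L[ℝ] ℝ) → ℝ := fun v => 1 / 2 * v (B v) + 1 / 2 * ‖v‖ ^ 2 - v a with hg
  have hva : ∀ v : X →L[ℝ] ℝ, v a ≤ ‖v‖ * ‖a‖ := fun v =>
    (le_abs_self _).trans (v.le_opNorm a)
  have hbdd : BddBelow (Set.range g) := by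
    refine ⟨-(1 / 2 * ‖a‖ ^ 2), ?_⟩
    rintro _ ⟨v, rfl⟩
    have h1 := hmono v
    have h2 := hva v
    simp only [hg]
    nlinarith [sq_nonneg (‖v‖ - ‖a‖)]
  set R : ℝ := 2 * ‖a‖ + 2 with hR
  set C : ℝ := ‖B‖ * (R + (‖a‖ + ‖B‖ * R)) ^ 2 with hC
  have hR0 : 0 ≤ R := by positivity
  have hC0 : 0 ≤ C := by positivity
  obtain ⟨t, ht0, ht1, htε⟩ : ∃ t : ℝ, 0 < t ∧ t ≤ 1 ∧ t * (1 + C) ≤ ε := by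
    refine ⟨min 1 (ε / (1 + C)), lt_min one_pos (by positivity), min_le_left _ _, ?_⟩
    exact (le_div_iff₀ (by positivity)).1 (min_le_right _ _)
  obtain ⟨v, hv⟩ := exists_lt_of_ciInf_lt (lt_add_of_pos_right (iInf g) (pow_pos ht0 2))
  have hmin : ∀ u, g v - t ^ 2 ≤ g u := fun u => by
    have := ciInf_le hbdd u
    linarith
  have hvR : ‖v‖ ≤ R := by
    have h1 := hmin 0
    have h2 := hmono v
    have h3 := hva v
    simp only [hg, map_zero, norm_zero, zero_apply] at h1
    by_contra! h
    have h4 := norm_nonneg a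
    nlinarith
  set p := a - B v with hp
  obtain ⟨f, hf1, hf2⟩ := exists_dual_vector'' ℝ p
  set u : X →L[ℝ] ℝ := ‖p‖ • f with hu
  have hup : u p = ‖p‖ ^ 2 := by
    rw [hu, smul_apply, hf2, smul_eq_mul, pow_two]
    rfl
  have hun : ‖u‖ ≤ ‖p‖ := by
    rw [hu, norm_smul, norm_norm]
    exact mul_le_of_le_one_right (norm_nonneg _) hf1
  have hpn : ‖p‖ ≤ ‖a‖ + ‖B‖ * R := by
    refine (norm_sub_le _ _).trans ?_
    gcongr
    exact (B.le_opNorm v).trans (by gcongr)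
  have hquad : (u - v) (B (u - v)) ≤ C := by
    have h1 : ‖u - v‖ ≤ R + (‖a‖ + ‖B‖ * R) := by
      linarith [norm_sub_le u v]
    calc (u - v) (B (u - v)) ≤ ‖u - v‖ * ‖B (u - v)‖ :=
          (le_abs_self _).trans ((u - v).le_opNorm _)
      _ ≤ ‖u - v‖ * (‖B‖ * ‖u - v‖) := by gcongr; exact B.le_opNorm _
      _ = ‖B‖ * ‖u - v‖ ^ 2 := by ring
      _ ≤ C := by rw [hC]; gcongr
  have hnorm : ‖v + t • (u - v)‖ ^ 2 ≤ (1 - t) * ‖v‖ ^ 2 + t * ‖p‖ ^ 2 := by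
    have h1 : ‖v + t • (u - v)‖ ≤ (1 - t) * ‖v‖ + t * ‖p‖ := by
      have h2 : v + t • (u - v) = (1 - t) • v + t • u := by module
      rw [h2]
      refine (norm_add_le _ _).trans ?_
      rw [norm_smul, norm_smul, Real.norm_of_nonneg ht0.le,
        Real.norm_of_nonneg (by linarith : 0 ≤ 1 - t)]
      gcongr
    have h3 := pow_le_pow_left₀ (norm_nonneg _) h1 2
    nlinarith [mul_nonneg (mul_nonneg ht0.le (by linarith : 0 ≤ 1 - t)) (sq_nonneg (‖v‖ - ‖p‖))]
  have hexp := hmin (v + t • (u - v))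
  have hs := hsym u v
  have hpu : u p = u a - u (B v) := map_sub _ _ _
  have hpv : v p = v a - v (B v) := map_sub _ _ _
  refine ⟨v, le_trans ?_ htε⟩
  refine le_of_mul_le_mul_left ?_ ht0
  simp only [hg, map_add, map_smul, map_sub, add_apply,
    smul_apply, sub_apply, smul_eq_mul] at hexp hquad
  have hq2 := mul_le_mul_of_nonneg_left hquad (sq_nonneg t)
  rw [hs] at hexp hq2
  have e1 : t * (u p) = t * (u a - u (B v)) := by rw [hpu]
  have e2 : t * (v p) = t * (v a - v (B v)) := by rw [hpv]
  rw [hup] at e1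
  nlinarith [mul_nonneg (sq_nonneg t) hC0]

theorem bwInv_eq (hsym : ∀ u v : X →L[ℝ] ℝ, v (B u) = u (B v))
    (hmono : ∀ u : X →L[ℝ] ℝ, 0 ≤ u (B u)) (x : X) (x' : X →L[ℝ] ℝ) :
    bwInv B (x, x') = qBstar B x + ((qB B x' : ℝ) : EReal) := by
  have hval : ∀ v : X →L[ℝ] ℝ,
      ((1 / 2 : ℝ) : EReal) * fitzInv B (x + (x - B (x' + v)), x' + -v)
        + ((1 / 2 : ℝ) : EReal) * conj2 (fitzInv B) (x' - -v, x - (x - B (x' + v)))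
        + ((1 / 2 * ‖x - B (x' + v)‖ ^ 2 + 1 / 2 * ‖-v‖ ^ 2 : ℝ) : EReal)
      = qBstar B x + ((qB B x' + (1 / 2 * ‖(x - B x') - B v‖ ^ 2 + 1 / 2 * ‖v‖ ^ 2
          - v ((x - B x') - B v)) : ℝ) : EReal) := by
    intro v
    rw [sub_sub_cancel, sub_neg_eq_add, conj2_fitzInv_apply hsym hmono,
      half_mul_fitzInv hsym (z := x + B (-v))
        (by simp only [map_add, map_neg, two_smul]; abel),
      qBstar_add_map hsym, norm_neg, map_add, sub_sub x]
    rw [← EReal.coe_mul, add_assoc, add_assoc, ← EReal.coe_add, ← EReal.coe_add]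
    congr 2
    have h := hsym x' v
    simp only [qB, map_add, map_neg, map_sub, add_apply,
      neg_apply]
    linarith
  apply le_antisymm
  · rcases eq_or_ne (qBstar B x) ⊤ with hs | hs
    · rw [hs, EReal.top_add_coe]
      exact le_top
    lift qBstar B x to ℝ using ⟨hs, qBstar_ne_bot x⟩ with s
    refine EReal.le_of_forall_lt_iff_le.1 fun z hz => ?_
    norm_cast at hz
    obtain ⟨v, hv⟩ := exists_fenchel_gap_le hsym hmono (x - B x') (sub_pos.2 hz)
    refine (iInf_le _ (x - B (x' + v), -v)).trans ((hval v).le.trans ?_)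
    norm_cast
    linarith
  · refine le_iInf ?_
    rintro ⟨y, y'⟩
    by_cases h : B (x' - y') = x - y
    · obtain ⟨v, rfl⟩ : ∃ v, y' = -v := ⟨-y', (neg_neg _).symm⟩
      obtain rfl : y = x - B (x' + v) := by rw [← sub_neg_eq_add, h, sub_sub_cancel]
      refine le_of_le_of_eq (add_le_add le_rfl ?_) (hval v).symm
      norm_cast
      have h1 := (le_abs_self _).trans (v.le_opNorm ((x - B x') - B v))
      nlinarith [sq_nonneg (‖v‖ - ‖(x - B x') - B v‖)]
    · simp only
      rw [conj2_fitzInv_eq_top hsym hmono h, EReal.coe_mul_top_of_pos (by norm_num),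
        EReal.add_top_of_ne_bot
          (lt_of_lt_of_le EReal.bot_lt_zero (half_mul_fitzInv_nonneg _ _)).ne', EReal.top_add_coe]
      exact le_top

end InverseOperator

/-- Theorem 6.4. Let `B : X* → X` be continuous, linear, symmetric,
monotone and one-to-one, and let `A = B⁻¹`. Then `𝒜_A = q_A ⊕ q_B = (q_B* + ι_{dom A}) ⊕ q_B`,
`ℬ_A = 𝒜_A** = q_B* ⊕ q_B`, both are representers for `A`, and `𝒜_A = ℬ_A` iff
`dom q_B* = dom A`. -/
theorem stmt18 {X : Type*} [NormedAddCommGroup X] [NormedSpace ℝ X] [CompleteSpace X]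
    (hrefl : Function.Surjective (NormedSpace.inclusionInDoubleDual ℝ X))
    (B : (X →L[ℝ] ℝ) →L[ℝ] X)
    (hsym : ∀ u v : X →L[ℝ] ℝ, v (B u) = u (B v))
    (hmono : ∀ u : X →L[ℝ] ℝ, 0 ≤ u (B u))
    (hinj : Function.Injective B) :
    (∀ (x : X) (x' : X →L[ℝ] ℝ),
      pzInv B (x, x') = qAinv B x + ((qB B x' : ℝ) : EReal) ∧
      pzInv B (x, x')
        = (qBstar B x + (if ∃ u : X →L[ℝ] ℝ, B u = x then (0 : EReal) else ⊤))
          + ((qB B x' : ℝ) : EReal)) ∧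
    (∀ (x : X) (x' : X →L[ℝ] ℝ),
      bwInv B (x, x') = conj2' (conj2 (pzInv B)) (x, x') ∧
      bwInv B (x, x') = qBstar B x + ((qB B x' : ℝ) : EReal)) ∧
    IsRepresenter (pzInv B) (invOp B) ∧
    IsRepresenter (bwInv B) (invOp B) ∧
    (pzInv B = bwInv B ↔ {x : X | qBstar B x ≠ ⊤} = {x : X | ∃ u : X →L[ℝ] ℝ, B u = x}) := by
  have hpz := pzInv_eq hsym hmono hinj
  have hbw := bwInv_eq hsym hmono
  have hqA := qAinv_eq hsym hmono hinj
  refine ⟨fun x x' => ⟨hpz x x', by rw [hpz, hqA]⟩,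
    fun x x' => ⟨by rw [hbw, conj2'_conj2_pzInv hsym hmono hinj], hbw x x'⟩, ?_, ?_, ?_⟩
  · intro x x'
    rw [hpz, hqA]
    split_ifs with hx
    · rw [add_zero, qBstar_add_eq_iff hsym hmono]
      rfl
    · rw [EReal.add_top_of_ne_bot (qBstar_ne_bot x), EReal.top_add_coe]
      exact ⟨fun h => absurd ⟨x', h⟩ hx, fun h => absurd h (EReal.coe_ne_top _).symm⟩
  · intro x x'
    rw [hbw, qBstar_add_eq_iff hsym hmono]
    rfl
  · have hran : ∀ x, (∃ u : X →L[ℝ] ℝ, B u = x) → qBstar B x ≠ ⊤ := by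
      rintro _ ⟨u, rfl⟩
      rw [qBstar_apply hsym hmono]
      exact EReal.coe_ne_top _
    constructor
    · intro h
      ext x
      refine ⟨fun hx => ?_, hran x⟩
      by_contra hx'
      rw [Set.mem_ofPred_eq] at hx'
      have h0 := congrFun h (x, 0)
      rw [hpz, hbw, hqA, if_neg hx', EReal.add_top_of_ne_bot (qBstar_ne_bot x)] at h0
      exact hx (by simpa [qB] using h0.symm)
    · intro h
      ext ⟨x, x'⟩
      rw [hpz, hbw, hqA]
      split_ifs with hx
      · rw [add_zero]
      · have h1 : qBstar B x = ⊤ := by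
          by_contra h2
          exact hx (h.subset h2)
        rw [h1, EReal.top_add_top]
end
end
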